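/- arXiv:1709.03137 — 3 statements merged into one kernel-verified Lean document; each statement's English description precedes it below -/
import Mathlib

section
/- There exist a universal constant c1 > 0 and, for each dimension d ≥ 1, a constant c2(d) > 0 and an integer n0(d) such that the following holds. Let G ⊆ ℝ^d be a convex body with |G| = 1, let X_1, …, X_n be i.i.d. points uniformly distributed in G, and let K̂_n be their convex hull. Then for every n ≥ n0(d): c1·|G(1/n)| ≤ E_G[|G \ K̂_n|] ≤ c2(d)·|G(1/n)|. -/
open MeasureTheory Metric Set
open scoped RealInnerProductSpace ENNReal

noncomputable section

abbrev Euc (d : ℕ) := EuclideanSpace ℝ (Fin d)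

/-- A convex body: a compact convex set with nonempty interior. -/
def IsConvexBody {d : ℕ} (G : Set (Euc d)) : Prop :=
  IsCompact G ∧ Convex ℝ G ∧ (interior G).Nonempty

/-- The uniform probability measure on `G` (normalized restriction of Lebesgue measure). -/
def unifMeasure {d : ℕ} (G : Set (Euc d)) : Measure (Euc d) :=
  (volume G)⁻¹ • volume.restrict G

instance {d : ℕ} (G : Set (Euc d)) : IsFiniteMeasure (unifMeasure G) := by
  constructor
  rw [unifMeasure, Measure.smul_apply, Measure.restrict_apply_univ, smul_eq_mul]
  exact (ENNReal.inv_mul_le_one _).trans_lt ENNReal.one_lt_top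

/-- Joint distribution of `n` i.i.d. points uniformly distributed in `G`. -/
def sampleMeasure {d : ℕ} (G : Set (Euc d)) (n : ℕ) : Measure (Fin n → Euc d) :=
  Measure.pi fun _ => unifMeasure G

/-- The `ε`-wet part of `G`: points of `G` contained in some closed halfspace `H`
with `|G ∩ H| < ε·|G|`. -/
def wetPart {d : ℕ} (G : Set (Euc d)) (ε : ℝ) : Set (Euc d) :=
  {x ∈ G | ∃ (u : Euc d) (c : ℝ), u ≠ 0 ∧ c ≤ ⟪u, x⟫ ∧
    volume (G ∩ {y | c ≤ ⟪u, y⟫}) < ENNReal.ofReal ε * volume G}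

section Radial

variable {E : Type*} [NormedAddCommGroup E] [NormedSpace ℝ E] [FiniteDimensional ℝ E]
  [MeasurableSpace E] [BorelSpace E]

/-- Integration in polar coordinates. -/
theorem lintegral_eq_lintegral_toSphere [Nontrivial E] (μ : Measure E) [μ.IsAddHaarMeasure]
    {F : E → ℝ≥0∞} (hF : Measurable F) :
    ∫⁻ x, F x ∂μ = ∫⁻ θ : sphere (0 : E) 1, (∫⁻ r in Ioi (0 : ℝ),
      ENNReal.ofReal (r ^ (Module.finrank ℝ E - 1)) * F (r • (θ : E))) ∂μ.toSphere := by
  have h1 : ∫⁻ x, F x ∂μ = ∫⁻ x : ({0}ᶜ : Set E), F x ∂(μ.comap (↑)) := by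
    rw [lintegral_subtype_comap (measurableSet_singleton _).compl,
      restrict_compl_singleton]
  have h2 : ∫⁻ x : ({0}ᶜ : Set E), F x ∂(μ.comap (↑)) =
      ∫⁻ p : sphere (0 : E) 1 × Ioi (0 : ℝ), F ((p.2 : ℝ) • (p.1 : E))
        ∂(μ.toSphere.prod (Measure.volumeIoiPow (Module.finrank ℝ E - 1))) := by
    rw [← μ.measurePreserving_homeomorphUnitSphereProd.lintegral_comp (by fun_prop)]
    refine lintegral_congr fun x => ?_
    have : ‖(x : E)‖ ≠ 0 := norm_ne_zero_iff.2 x.2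
    simp [smul_smul, this]
  rw [h1, h2, lintegral_prod _ (by fun_prop)]
  refine lintegral_congr fun θ => ?_
  rw [Measure.volumeIoiPow, lintegral_withDensity_eq_lintegral_mul _ (by fun_prop) (by fun_prop)]
  exact lintegral_subtype_comap measurableSet_Ioi
    (fun r : ℝ => ENNReal.ofReal (r ^ (Module.finrank ℝ E - 1)) * F (r • (θ : E)))

/-- If along every ray from the origin `F` is dominated by `H` composed with the contraction of
ratio `c` towards an end point of the ray, then the integral of `F` is at most `c⁻¹` times that
of `H`. -/
theorem mul_lintegral_le_of_radial [Nontrivial E] (μ : Measure E) [μ.IsAddHaarMeasure]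
    {F H : E → ℝ≥0∞} (hF : Measurable F) (hH : Measurable H) {c : ℝ} (hc0 : 0 < c) (hc1 : c ≤ 1)
    (h : ∀ θ : E, ‖θ‖ = 1 → ∃ R : ℝ, ∀ r : ℝ, 0 < r → (R < r → F (r • θ) = 0) ∧
      (r < R → F (r • θ) ≤ H (((1 - c) * R + c * r) • θ))) :
    ENNReal.ofReal c * ∫⁻ x, F x ∂μ ≤ ∫⁻ x, H x ∂μ := by
  rw [lintegral_eq_lintegral_toSphere μ hF, lintegral_eq_lintegral_toSphere μ hH,
    ← lintegral_const_mul' _ _ ENNReal.ofReal_ne_top]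
  refine lintegral_mono fun θ => ?_
  obtain ⟨R, hR⟩ := h θ (by simp)
  set k := Module.finrank ℝ E - 1
  set g : ℝ → ℝ≥0∞ := fun r => ENNReal.ofReal (r ^ k) * H (r • (θ : E)) with hg
  have hsub : (fun r => (1 - c) * R + c * r) '' Ioo 0 R ⊆ Ioi 0 := by
    rintro _ ⟨r, ⟨hr0, hrR⟩, rfl⟩
    have : 0 ≤ (1 - c) * R := mul_nonneg (by linarith) (by linarith)
    exact mem_Ioi.2 (by positivity)
  have hcv := lintegral_image_eq_lintegral_abs_deriv_mul (measurableSet_Ioo (a := (0:ℝ)) (b := R))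
    (f := fun r => (1 - c) * R + c * r) (f' := fun _ => c)
    (fun x _ => by
      simpa using (((hasDerivAt_id x).const_mul c).const_add ((1 - c) * R)).hasDerivWithinAt)
    (fun x _ y _ hxy => by simpa [hc0.ne'] using hxy) g
  calc ENNReal.ofReal c * ∫⁻ r in Ioi (0:ℝ), ENNReal.ofReal (r ^ k) * F (r • (θ : E))
      ≤ ENNReal.ofReal c * ∫⁻ r in Ioo 0 R, g ((1 - c) * R + c * r) := by
        refine mul_le_mul_right ?_ _
        rw [← lintegral_indicator measurableSet_Ioi, ← lintegral_indicator measurableSet_Ioo]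
        have hne : ∀ᵐ r : ℝ, r ≠ R := by simp [ae_iff, measure_singleton]
        refine lintegral_mono_ae ?_
        filter_upwards [hne] with r hr
        by_cases hr0 : 0 < r
        · rcases lt_or_gt_of_ne hr with hlt | hgt
          · rw [indicator_of_mem (mem_Ioi.2 hr0), indicator_of_mem (mem_Ioo.2 ⟨hr0, hlt⟩), hg]
            have : r ≤ (1 - c) * R + c * r := by nlinarith
            dsimp only
            gcongr
            exact ((hR r hr0).2 hlt)
          · rw [indicator_of_mem (mem_Ioi.2 hr0), (hR r hr0).1 hgt]
            simp
        · rw [indicator_of_notMem (by simpa using hr0)]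
          exact zero_le
    _ = ∫⁻ r in (fun r => (1 - c) * R + c * r) '' Ioo 0 R, g r := by
        rw [hcv, ← lintegral_const_mul' _ _ ENNReal.ofReal_ne_top, abs_of_pos hc0]
    _ ≤ ∫⁻ r in Ioi (0:ℝ), g r := lintegral_mono_set hsub

end Radial

section CrossPolytope

variable {d : ℕ} {G : Set (Euc d)}

/-- The determinant of `d` vectors of `ℝ^d` in the standard basis. -/
def stdDet (e : Fin d → Euc d) : ℝ :=
  (EuclideanSpace.basisFun (Fin d) ℝ).toBasis.det e

/-- The families `e` such that the cross-polytope with vertices `x ± e i` is contained in `G`. -/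
def crossFamilies (G : Set (Euc d)) (x : Euc d) : Set (Fin d → Euc d) :=
  {e | ∀ i, x + e i ∈ G ∧ x - e i ∈ G}

/-- `x` is the center of a cross-polytope contained in `G` whose half axes span a parallelepiped
of volume at least `s`. -/
def IsDeep (G : Set (Euc d)) (s : ℝ) (x : Euc d) : Prop :=
  x ∈ G ∧ ∃ e ∈ crossFamilies G x, s ≤ |stdDet e|

theorem continuous_stdDet : Continuous (stdDet : (Fin d → Euc d) → ℝ) := by
  have : (stdDet : (Fin d → Euc d) → ℝ) = fun e => (Matrix.of fun i j => e j i).det := by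
    funext e
    rw [stdDet, Module.Basis.det_apply]
    congr 1
  rw [this]
  refine Continuous.matrix_det ?_
  refine continuous_pi fun i => continuous_pi fun j => ?_
  simp only [Matrix.of_apply]
  fun_prop

theorem stdDet_smul (c : ℝ) (e : Fin d → Euc d) :
    stdDet (fun i => c • e i) = c ^ d * stdDet e := by
  have := (EuclideanSpace.basisFun (Fin d) ℝ).toBasis.det.map_smul_univ (fun _ => c) e
  simpa [stdDet] using this

theorem abs_stdDet_signs {σ : Fin d → ℝ} (hσ : ∀ i, |σ i| = 1) (e : Fin d → Euc d) :
    |stdDet (fun i => σ i • e i)| = |stdDet e| := by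
  have := (EuclideanSpace.basisFun (Fin d) ℝ).toBasis.det.map_smul_univ σ e
  simp only [stdDet]
  rw [this, smul_eq_mul, abs_mul, Finset.abs_prod]
  simp [hσ]

theorem volume_parallelepiped_eq (e : Fin d → Euc d) :
    volume (parallelepiped e) = ENNReal.ofReal |stdDet e| := by
  rw [← (EuclideanSpace.basisFun (Fin d) ℝ).addHaar_eq_volume]
  exact Measure.addHaar_parallelepiped _ _

/-- Cramer's rule. -/
theorem exists_basis_of_stdDet_ne_zero {e : Fin d → Euc d} (he : stdDet e ≠ 0) :
    ∃ B : Module.Basis (Fin d) ℝ (Euc d), (∀ i, B i = e i) ∧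
      ∀ w j, stdDet (Function.update e j w) = B.repr w j * stdDet e := by
  obtain ⟨hli, hsp⟩ := ((EuclideanSpace.basisFun (Fin d) ℝ).toBasis.is_basis_iff_det).2
    (isUnit_iff_ne_zero.2 he)
  refine ⟨Module.Basis.mk hli hsp.ge, fun i => by simp, fun w j => ?_⟩
  have := (EuclideanSpace.basisFun (Fin d) ℝ).toBasis.det_smul_mk_coord_eq_det_update hli hsp.ge j
  have := congrArg (fun f => f w) this
  simp only [LinearMap.smul_apply, smul_eq_mul, MultilinearMap.toLinearMap_apply] at this
  rw [mul_comm]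
  exact this.symm

open scoped Pointwise in
theorem isCompact_setOf_cross (hG : IsCompact G) :
    IsCompact {p : Euc d × (Fin d → Euc d) | p.1 ∈ G ∧ p.2 ∈ crossFamilies G p.1} := by
  have hGG : IsCompact (G - G) := by
    rw [← Set.sub_image_prod]
    exact (hG.prod hG).image (by fun_prop)
  have hK : IsCompact (G ×ˢ univ.pi fun _ : Fin d => G - G) :=
    hG.prod (isCompact_univ_pi fun _ => hGG)
  refine hK.of_isClosed_subset ?_ ?_
  · have hc := hG.isClosed
    have h1 : ∀ i, IsClosed {p : Euc d × (Fin d → Euc d) | p.1 + p.2 i ∈ G} := fun i =>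
      hc.preimage (by fun_prop)
    have h2 : ∀ i, IsClosed {p : Euc d × (Fin d → Euc d) | p.1 - p.2 i ∈ G} := fun i =>
      hc.preimage (by fun_prop)
    convert (hc.preimage continuous_fst).inter (isClosed_iInter fun i => (h1 i).inter (h2 i))
    ext p
    simp [crossFamilies]
  · rintro ⟨x, e⟩ ⟨hx, he⟩
    refine ⟨hx, fun i _ => ?_⟩
    exact ⟨x + e i, (he i).1, x, hx, by simp⟩

theorem isClosed_setOf_isDeep (hG : IsCompact G) (s : ℝ) : IsClosed {x | IsDeep G s x} := by
  have h1 : IsCompact ({p : Euc d × (Fin d → Euc d) | p.1 ∈ G ∧ p.2 ∈ crossFamilies G p.1} ∩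
      {p | s ≤ |stdDet p.2|}) :=
    (isCompact_setOf_cross hG).inter_right (isClosed_le continuous_const
      (continuous_stdDet.comp continuous_snd).abs)
  convert (h1.image continuous_fst).isClosed using 1
  ext x
  constructor
  · rintro ⟨hx, e, he, hs⟩
    exact ⟨(x, e), ⟨⟨hx, he⟩, hs⟩, rfl⟩
  · rintro ⟨⟨y, e⟩, ⟨⟨hx, he⟩, hs⟩, rfl⟩
    exact ⟨hx, e, he, hs⟩

theorem exists_max_cross (hG : IsCompact G) (hne : G.Nonempty) :
    ∃ o ∈ G, ∃ e ∈ crossFamilies G o, ∀ x ∈ G, ∀ e' ∈ crossFamilies G x,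
      |stdDet e'| ≤ |stdDet e| := by
  obtain ⟨x, hx⟩ := hne
  have hf : Continuous fun p : Euc d × (Fin d → Euc d) => |stdDet p.2| :=
    (continuous_stdDet.comp continuous_snd).abs
  obtain ⟨p, hp, hmax⟩ := (isCompact_setOf_cross hG).exists_isMaxOn
    ⟨(x, 0), hx, fun i => by simpa using hx⟩ hf.continuousOn
  refine ⟨p.1, hp.1, p.2, hp.2, fun y hy e' he' => ?_⟩
  exact isMaxOn_iff.1 hmax (y, e') ⟨hy, he'⟩

theorem exists_max_cross_at (hG : IsCompact G) {x : Euc d} (hx : x ∈ G) :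
    ∃ e ∈ crossFamilies G x, ∀ e' ∈ crossFamilies G x, |stdDet e'| ≤ |stdDet e| := by
  have hK : IsCompact (crossFamilies G x) := by
    convert ((isCompact_setOf_cross hG).inter_right
      (isClosed_singleton.preimage continuous_fst : IsClosed (Prod.fst ⁻¹' {x}))).image
        continuous_snd using 1
    ext e
    constructor
    · intro he
      exact ⟨(x, e), ⟨⟨hx, he⟩, rfl⟩, rfl⟩
    · rintro ⟨⟨y, e⟩, ⟨⟨-, he⟩, rfl⟩, rfl⟩
      exact he
  obtain ⟨e, he, hmax⟩ := hK.exists_isMaxOn ⟨0, fun i => by simpa using hx⟩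
    continuous_stdDet.abs.continuousOn
  exact ⟨e, he, fun e' he' => hmax he'⟩

theorem exists_cross_ne_zero {x : Euc d} (hx : x ∈ interior G) :
    ∃ e ∈ crossFamilies G x, stdDet e ≠ 0 := by
  obtain ⟨r, hr, hball⟩ := Metric.isOpen_iff.1 isOpen_interior x hx
  refine ⟨fun i => (r / 2) • EuclideanSpace.basisFun (Fin d) ℝ i, fun i => ?_, ?_⟩
  · have hn : ‖(r / 2) • EuclideanSpace.basisFun (Fin d) ℝ i‖ < r := by
      rw [norm_smul]
      simp only [OrthonormalBasis.norm_eq_one, Real.norm_eq_abs, abs_of_pos (half_pos hr)]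
      linarith
    constructor <;> refine interior_subset (hball ?_) <;> simpa [dist_eq_norm] using hn
  · rw [stdDet_smul]
    have : stdDet (fun i => EuclideanSpace.basisFun (Fin d) ℝ i) = 1 := by
      rw [stdDet, ← (EuclideanSpace.basisFun (Fin d) ℝ).coe_toBasis]
      exact Module.Basis.det_self _
    rw [this]
    positivity

end CrossPolytope

section Caps

variable {d : ℕ} {G : Set (Euc d)}

theorem exists_reflection_mem_of_mem_convexHull (hd : 1 ≤ d) (hconv : Convex ℝ G)
    {S : Set (Euc d)} (hS : S ⊆ G) {x : Euc d} (hx : x ∈ convexHull ℝ S) :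
    ∃ g ∈ S, x - (d : ℝ)⁻¹ • (g - x) ∈ G := by
  obtain ⟨ι, _, z, w, hz, hind, hw, hsum, hxs⟩ := eq_pos_convex_span_of_mem_convexHull hx
  have hd0 : (0 : ℝ) < d := by exact_mod_cast hd
  have hcard : (Fintype.card ι : ℝ) ≤ d + 1 := by
    have h1 := hind.card_le_finrank_succ
    have h2 := Submodule.finrank_le (vectorSpan ℝ (Set.range z))
    rw [finrank_euclideanSpace_fin] at h2
    exact_mod_cast h1.trans (by omega)
  obtain ⟨i, hi⟩ : ∃ i, 1 / ((d : ℝ) + 1) ≤ w i := by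
    by_contra! hcon
    have hne : (Finset.univ : Finset ι).Nonempty := by
      by_contra hne
      rw [Finset.not_nonempty_iff_eq_empty] at hne
      simp [hne] at hsum
    have h1 : ∑ i, w i < ∑ _i : ι, 1 / ((d : ℝ) + 1) :=
      Finset.sum_lt_sum_of_nonempty hne fun i _ => hcon i
    rw [hsum, Finset.sum_const, Finset.card_univ, nsmul_eq_mul, mul_one_div,
      lt_div_iff₀ (by positivity)] at h1
    linarith
  refine ⟨z i, hz ⟨i, rfl⟩, ?_⟩
  classical
  have key : x - (d : ℝ)⁻¹ • (z i - x) =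
      ∑ j, ((1 + (d : ℝ)⁻¹) * w j - if j = i then (d : ℝ)⁻¹ else 0) • z j := by
    simp only [sub_smul, Finset.sum_sub_distrib, ite_smul, zero_smul, Finset.sum_ite_eq',
      Finset.mem_univ, if_true, mul_smul, ← Finset.smul_sum, hxs]
    module
  rw [key]
  refine hconv.sum_mem (fun j _ => ?_) ?_ fun j _ => hS (hz ⟨j, rfl⟩)
  · split_ifs with hji
    · subst hji
      have : (1 + (d : ℝ)⁻¹) * (1 / ((d : ℝ) + 1)) = (d : ℝ)⁻¹ := by field_simp
      have h2 : (1 + (d : ℝ)⁻¹) * (1 / ((d : ℝ) + 1)) ≤ (1 + (d : ℝ)⁻¹) * w j := by gcongr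
      linarith
    · have := hw j
      simp only [sub_zero]
      positivity
  · simp [Finset.sum_sub_distrib, ← Finset.mul_sum, hsum]

theorem exists_reflection_mem_of_mem_closure_convexHull (hd : 1 ≤ d) (hG : IsCompact G)
    (hconv : Convex ℝ G) {S : Set (Euc d)} (hS : S ⊆ G) (hScomp : IsCompact S) {x : Euc d}
    (hx : x ∈ closure (convexHull ℝ S)) :
    ∃ g ∈ S, x - (d : ℝ)⁻¹ • (g - x) ∈ G := by
  have hd0 : (0 : ℝ) < d := by exact_mod_cast hd
  have hclosed : IsClosed ((fun p : Euc d × Euc d => ((d : ℝ) + 1)⁻¹ • ((d : ℝ) • p.2 + p.1)) ''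
      (S ×ˢ G)) := ((hScomp.prod hG).image (by fun_prop)).isClosed
  have hsub : convexHull ℝ S ⊆
      (fun p : Euc d × Euc d => ((d : ℝ) + 1)⁻¹ • ((d : ℝ) • p.2 + p.1)) '' (S ×ˢ G) := by
    intro y hy
    obtain ⟨g, hg, hgy⟩ := exists_reflection_mem_of_mem_convexHull hd hconv hS hy
    refine ⟨(g, _), ⟨hg, hgy⟩, ?_⟩
    dsimp only
    match_scalars <;> field_simp <;> ring
  obtain ⟨⟨g, y⟩, ⟨hg, hy⟩, rfl⟩ := closure_minimal hsub hclosed hx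
  refine ⟨g, hg, ?_⟩
  convert hy using 1
  dsimp only
  match_scalars <;> field_simp <;> ring

/-- An interior point which is not `s`-deep lies in a halfspace cutting off from `G` a volume
less than a dimensional multiple of `s`. -/
theorem exists_cap_volume_lt (hd : 1 ≤ d) (hG : IsCompact G) (hconv : Convex ℝ G) {x : Euc d}
    (hx : x ∈ interior G) {s : ℝ} (hs : ¬ IsDeep G s x) :
    ∃ (u : Euc d) (c : ℝ), u ≠ 0 ∧ c ≤ ⟪u, x⟫ ∧
      volume (G ∩ {y | c ≤ ⟪u, y⟫}) < ENNReal.ofReal ((4 * d) ^ d * s) := by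
  have hd0 : (0 : ℝ) < d := by exact_mod_cast hd
  have hxG := interior_subset hx
  obtain ⟨e, he, hmax⟩ := exists_max_cross_at hG hxG
  obtain ⟨e₁, he₁, hdet₁⟩ := exists_cross_ne_zero hx
  have hdet : 0 < |stdDet e| := (abs_pos.2 hdet₁).trans_le (hmax _ he₁)
  have hlt : |stdDet e| < s := by
    by_contra! hcon
    exact hs ⟨hxG, e, he, hcon⟩
  obtain ⟨B, hB, hBdet⟩ := exists_basis_of_stdDet_ne_zero (abs_pos.1 hdet)
  have hcont : ∀ i, Continuous fun y => B.repr (y - x) i := fun i =>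
    (LinearMap.continuous_of_finiteDimensional (B.coord i)).comp (continuous_sub_right x)
  set S : Set (Euc d) := {y ∈ G | ∃ i, 2 * (d : ℝ) ≤ |B.repr (y - x) i|} with hSdef
  have hScomp : IsCompact S := by
    refine hG.inter_right ?_
    have : {y | ∃ i, 2 * (d : ℝ) ≤ |B.repr (y - x) i|} =
        ⋃ i, {y | 2 * (d : ℝ) ≤ |B.repr (y - x) i|} := by ext; simp
    change IsClosed {y | ∃ i, 2 * (d : ℝ) ≤ |B.repr (y - x) i|}
    rw [this]
    exact isClosed_iUnion_of_finite fun i => isClosed_le continuous_const (hcont i).abs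
  have hxS : x ∉ closure (convexHull ℝ S) := by
    intro hmem
    obtain ⟨g, ⟨hgG, i, hi⟩, hrefl⟩ :=
      exists_reflection_mem_of_mem_closure_convexHull hd hG hconv (fun y hy => hy.1) hScomp hmem
    set y := (d : ℝ)⁻¹ • (g - x) with hy
    have hyG : x + y ∈ G := by
      have := hconv.add_smul_sub_mem hxG hgG (t := (d : ℝ)⁻¹)
        ⟨by positivity, inv_le_one_of_one_le₀ (by exact_mod_cast hd)⟩
      exact this
    have hup : Function.update e i y ∈ crossFamilies G x := by
      intro j
      by_cases hj : j = i
      · subst hj; simpa using ⟨hyG, hrefl⟩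
      · simpa [Function.update_of_ne hj] using he j
    have h1 := hmax _ hup
    rw [hBdet, abs_mul, mul_le_iff_le_one_left hdet, hy, map_smul, Finsupp.smul_apply,
      smul_eq_mul, abs_mul, abs_of_pos (inv_pos.2 hd0), inv_mul_le_iff₀ hd0] at h1
    linarith
  obtain ⟨u, c, hu, hcx, hsep⟩ : ∃ (u : Euc d) (c : ℝ), u ≠ 0 ∧ c ≤ ⟪u, x⟫ ∧
      ∀ y ∈ S, ⟪u, y⟫ < c := by
    rcases S.eq_empty_or_nonempty with hemp | ⟨y, hy⟩
    · have : Nonempty (Fin d) := ⟨⟨0, hd⟩⟩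
      obtain ⟨u, hu⟩ := exists_ne (0 : Euc d)
      exact ⟨u, _, hu, le_rfl, by simp [hemp]⟩
    · obtain ⟨f, c, h1, h2⟩ := geometric_hahn_banach_closed_point
        (convex_convexHull ℝ S).closure isClosed_closure hxS
      refine ⟨(InnerProductSpace.toDual ℝ _).symm f, c, ?_, ?_, fun y hy => ?_⟩
      · intro h0
        have hf : f = 0 := by simpa using h0
        have h3 := h1 y (subset_closure (subset_convexHull ℝ S hy))
        simp only [hf, zero_apply] at h2 h3
        linarith
      · simpa using h2.le
      · simpa using h1 y (subset_closure (subset_convexHull ℝ S hy))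
  refine ⟨u, c, hu, hcx, ?_⟩
  have hsub : G ∩ {y | c ≤ ⟪u, y⟫} ⊆ (fun z => (x - ∑ i, (2 * (d : ℝ)) • e i) + z) ''
      parallelepiped (fun i => (4 * (d : ℝ)) • e i) := by
    rintro y ⟨hyG, hyc⟩
    have hyS : ∀ i, |B.repr (y - x) i| < 2 * d := by
      intro i
      by_contra! hcon
      exact absurd (hsep y ⟨hyG, i, hcon⟩) (not_lt.2 hyc)
    refine ⟨∑ i, ((B.repr (y - x) i + 2 * d) / (4 * d)) • (4 * (d : ℝ)) • e i, ?_, ?_⟩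
    · rw [mem_parallelepiped_iff]
      refine ⟨fun i => (B.repr (y - x) i + 2 * d) / (4 * d), ⟨fun i => ?_, fun i => ?_⟩, rfl⟩
      · have := (abs_lt.1 (hyS i)).1
        exact div_nonneg (by linarith) (by positivity)
      · have := (abs_lt.1 (hyS i)).2
        exact (div_le_one (by positivity)).2 (by linarith)
    · have h1 : ∑ i, B.repr (y - x) i • e i = y - x := by
        simpa only [hB] using B.sum_repr (y - x)
      have h2 : ∀ i, ((B.repr (y - x) i + 2 * d) / (4 * d)) • (4 * (d : ℝ)) • e i =
          B.repr (y - x) i • e i + (2 * (d : ℝ)) • e i := by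
        intro i
        rw [smul_smul, div_mul_cancel₀ _ (by positivity), add_smul]
      simp only [h2, Finset.sum_add_distrib, h1]
      abel
  refine (measure_mono hsub).trans_lt ?_
  rw [image_add_left, measure_preimage_add, volume_parallelepiped_eq, stdDet_smul, abs_mul,
    abs_of_pos (by positivity)]
  exact (ENNReal.ofReal_lt_ofReal_iff (mul_pos (by positivity) (hdet.trans hlt))).2 (by gcongr)

end Caps

section Growth

variable {d : ℕ} {G : Set (Euc d)}

/-- Moving away from a boundary point `b`, the largest cross-polytope grows at least linearly. -/
theorem exists_cross_of_cross_near_boundary (hd : 1 ≤ d) (hconv : Convex ℝ G) {b o : Euc d}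
    (hb : b ∈ G) (ho : o ∈ G) {f : StrongDual ℝ (Euc d)} (hf0 : f ≠ 0)
    (hf : ∀ y ∈ G, f y ≤ f b) {c a : ℝ} (hc0 : 0 < c) (hc : c ≤ 1 / 2) (ha0 : 0 ≤ a)
    (ha : a ≤ 1 / 2) {e : Fin d → Euc d} (he : e ∈ crossFamilies G (b + (c * a) • (o - b)))
    (hdet : stdDet e ≠ 0) :
    ∃ e' ∈ crossFamilies G (b + a • (o - b)), |stdDet e| ≤ 2 ^ d * d * c * |stdDet e'| := by
  have hd0 : (0 : ℝ) < d := by exact_mod_cast hd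
  have hca : 0 ≤ c * a := by positivity
  have hz : ∀ t : ℝ, 0 ≤ t → t ≤ 1 → b + t • (o - b) ∈ G := fun t h0 h1 =>
    hconv.add_smul_sub_mem hb ho ⟨h0, h1⟩
  set P := a * (f b - f o) with hP
  have hfe : ∀ i, |f (e i)| ≤ c * P := by
    intro i
    have h1 := hf _ (he i).1
    have h2 := hf _ (he i).2
    simp only [map_add, map_sub, map_smul, smul_eq_mul] at h1 h2
    rw [abs_le]
    constructor <;> rw [hP] <;> linarith
  set e₂ : Fin d → Euc d := fun i => (1 / 2 : ℝ) • e i with he₂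
  have hdet₂ : stdDet e₂ = (1 / 2) ^ d * stdDet e := stdDet_smul _ _
  have hdet₂' : stdDet e₂ ≠ 0 := by rw [hdet₂]; positivity
  obtain ⟨B, hB, hBdet⟩ := exists_basis_of_stdDet_ne_zero hdet₂'
  have hPpos : 0 < P := by
    have hP0 : 0 ≤ P := mul_nonneg ha0 (by linarith [hf o ho])
    refine hP0.lt_of_ne fun h0 => hf0 ?_
    have : (f : Euc d →ₗ[ℝ] ℝ) = 0 := by
      refine B.ext fun i => ?_
      have h1 : f (e i) = 0 := by simpa [← h0] using hfe i
      simp [hB, he₂, h1]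
    ext y
    exact congrArg (fun g => g y) this
  set w : Euc d := ((1 - c) * a) • (o - b) with hw
  have hfw : f w = - ((1 - c) * P) := by
    simp only [hw, map_smul, map_sub, smul_eq_mul, hP]
    ring
  obtain ⟨j, hj⟩ : ∃ j, 1 / (c * d) ≤ |B.repr w j| := by
    by_contra! hcon
    have hsum : f w = ∑ i, B.repr w i * ((1 / 2) * f (e i)) := by
      conv_lhs => rw [← B.sum_repr w]
      simp [hB, he₂]
    have hle : |f w| < ∑ _i : Fin d, 1 / (c * d) * ((1 / 2) * (c * P)) := by
      rw [hsum]
      refine (Finset.abs_sum_le_sum_abs _ _).trans_lt ?_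
      refine Finset.sum_lt_sum_of_nonempty ⟨⟨0, hd⟩, Finset.mem_univ _⟩ fun i _ => ?_
      rw [abs_mul, abs_mul, abs_of_pos (by norm_num : (0 : ℝ) < 1 / 2)]
      refine (mul_le_mul_of_nonneg_left (mul_le_mul_of_nonneg_left (hfe i) (by norm_num))
        (abs_nonneg _)).trans_lt ?_
      exact mul_lt_mul_of_pos_right (hcon i) (by positivity)
    rw [hfw, abs_neg, abs_of_pos (mul_pos (by linarith) hPpos), Finset.sum_const,
      Finset.card_univ, Fintype.card_fin, nsmul_eq_mul] at hle
    have : (d : ℝ) * (1 / (c * d) * ((1 / 2) * (c * P))) = (1 / 2) * P := by field_simp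
    rw [this] at hle
    nlinarith
  refine ⟨Function.update e₂ j w, fun i => ?_, ?_⟩
  · have hq := hz (2 * a - c * a) (by nlinarith) (by linarith)
    by_cases hi : i = j
    · subst hi
      have hq' := hz (c * a) hca (by nlinarith)
      rw [Function.update_self]
      constructor
      · convert hq using 1
        rw [hw]; module
      · convert hq' using 1
        rw [hw]; module
    · rw [Function.update_of_ne hi]
      have h1 := hconv (he i).1 hq (by norm_num : (0 : ℝ) ≤ 1 / 2) (by norm_num : (0 : ℝ) ≤ 1 / 2)
        (by norm_num)
      have h2 := hconv (he i).2 hq (by norm_num : (0 : ℝ) ≤ 1 / 2) (by norm_num : (0 : ℝ) ≤ 1 / 2)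
        (by norm_num)
      constructor
      · convert h1 using 1
        rw [he₂]; module
      · convert h2 using 1
        rw [he₂]; module
  · rw [hBdet, hdet₂, abs_mul, abs_mul, abs_of_pos (by positivity : (0 : ℝ) < (1 / 2) ^ d)]
    calc |stdDet e| = 2 ^ d * d * c * (1 / (c * d) * ((1 / 2) ^ d * |stdDet e|)) := by
          field_simp
          rw [← mul_pow]; norm_num
      _ ≤ _ := by gcongr

/-- The dimensional constant in the growth estimate for the set of shallow points. -/
def growthConst (d : ℕ) : ℝ := 2 ^ (2 * d + 1) * d

theorem exists_cross_of_cross_contraction (hd : 1 ≤ d) (hconv : Convex ℝ G) {b o : Euc d}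
    (hb : b ∈ G) (ho : o ∈ G) {e₀ : Fin d → Euc d} (he₀ : e₀ ∈ crossFamilies G o)
    (hmax : ∀ x ∈ G, ∀ e' ∈ crossFamilies G x, |stdDet e'| ≤ |stdDet e₀|)
    {f : StrongDual ℝ (Euc d)} (hf0 : f ≠ 0)
    (hf : ∀ y ∈ G, f y ≤ f b) {c a : ℝ} (hc0 : 0 < c) (hc : c ≤ 1 / 4) (ha0 : 0 ≤ a)
    (ha : a ≤ 1) {e : Fin d → Euc d} (he : e ∈ crossFamilies G (b + (c * a) • (o - b))) :
    ∃ e' ∈ crossFamilies G (b + a • (o - b)), |stdDet e| ≤ growthConst d * c * |stdDet e'| := by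
  have hz : ∀ t : ℝ, 0 ≤ t → t ≤ 1 → b + t • (o - b) ∈ G := fun t h0 h1 =>
    hconv.add_smul_sub_mem hb ho ⟨h0, h1⟩
  by_cases hdet : stdDet e = 0
  · refine ⟨0, fun i => by simpa using hz a ha0 ha, ?_⟩
    rw [hdet, abs_zero, growthConst]
    positivity
  rcases le_total a (1 / 2) with ha2 | ha2
  · obtain ⟨e', he', h⟩ := exists_cross_of_cross_near_boundary hd hconv hb ho hf0 hf hc0
      (by linarith) ha0 ha2 he hdet
    refine ⟨e', he', h.trans ?_⟩
    rw [growthConst]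
    gcongr
    · norm_num
    · omega
  · have heq : c * a = (2 * c * a) * (1 / 2) := by ring
    rw [heq] at he
    obtain ⟨e', he', h⟩ := exists_cross_of_cross_near_boundary hd hconv hb ho hf0 hf
      (c := 2 * c * a) (by positivity) (by nlinarith) (by norm_num) le_rfl he hdet
    refine ⟨fun i => a • e₀ i, fun i => ⟨?_, ?_⟩, ?_⟩
    · convert hconv.add_smul_sub_mem hb (he₀ i).1 ⟨ha0, ha⟩ using 1
      module
    · convert hconv.add_smul_sub_mem hb (he₀ i).2 ⟨ha0, ha⟩ using 1
      module
    · rw [stdDet_smul, abs_mul, abs_of_nonneg (by positivity : 0 ≤ a ^ d)]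
      have h1 := hmax _ (hz (1 / 2) (by norm_num) (by norm_num)) e' he'
      have h2 : (1 : ℝ) ≤ 2 ^ d * a ^ d := by
        rw [← mul_pow]; exact one_le_pow₀ (by linarith)
      calc |stdDet e| ≤ 2 ^ d * d * (2 * c * a) * |stdDet e'| := h
        _ ≤ 2 ^ d * d * (2 * c * 1) * (2 ^ d * a ^ d * |stdDet e₀|) := by
          gcongr
          exact h1.trans (le_mul_of_one_le_left (abs_nonneg _) h2)
        _ = growthConst d * c * (a ^ d * |stdDet e₀|) := by
          rw [growthConst]; ring

/-- The volume of the set of points of `G` that are not `s`-deep grows at most linearly in `s`. -/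
theorem mul_volume_not_isDeep_le (hd : 1 ≤ d) (hG : IsConvexBody G) (s : ℝ) {c : ℝ}
    (hc0 : 0 < c) (hc : c ≤ 1 / 4) :
    ENNReal.ofReal c * volume {x ∈ G | ¬ IsDeep G s x} ≤
      volume {x ∈ G | ¬ IsDeep G (growthConst d * c * s) x} := by
  obtain ⟨hcomp, hconv, hint⟩ := hG
  have : Nonempty (Fin d) := ⟨⟨0, hd⟩⟩
  obtain ⟨o, ho, e₀, he₀, hmax⟩ := exists_max_cross hcomp (hint.mono interior_subset)
  have hK : 0 < growthConst d := by rw [growthConst]; positivity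
  have hmeas : ∀ t, MeasurableSet {x ∈ G | ¬ IsDeep G t x} := fun t =>
    hcomp.isClosed.measurableSet.diff (isClosed_setOf_isDeep hcomp t).measurableSet
  have htrans : ∀ t, volume {x ∈ G | ¬ IsDeep G t x} =
      ∫⁻ y, ((o + ·) ⁻¹' {x ∈ G | ¬ IsDeep G t x}).indicator 1 y := fun t => by
    rw [lintegral_indicator_one ((hmeas t).preimage (measurable_const_add o)),
      measure_preimage_add]
  rw [htrans, htrans]
  refine mul_lintegral_le_of_radial volume
    (measurable_one.indicator ((hmeas _).preimage (measurable_const_add o)))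
    (measurable_one.indicator ((hmeas _).preimage (measurable_const_add o))) hc0 (by linarith)
    fun θ hθ => ?_
  have hray : Continuous fun r : ℝ => o + r • θ := by fun_prop
  set T : Set ℝ := {r | o + r • θ ∈ G} with hT
  have hTc : IsClosed T := hcomp.isClosed.preimage hray
  have hTb : BddAbove T := by
    obtain ⟨M, hM⟩ := hcomp.isBounded.exists_norm_le
    refine ⟨M + ‖o‖, fun r hr => ?_⟩
    have h1 := hM _ hr
    have h2 : ‖r • θ‖ ≤ ‖o + r • θ‖ + ‖o‖ := by
      simpa using norm_sub_le (o + r • θ) o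
    rw [norm_smul, hθ, mul_one] at h2
    exact (le_abs_self r).trans (h2.trans (by linarith))
  have hT0 : (0 : ℝ) ∈ T := by simpa [hT] using ho
  set R := sSup T with hR
  have hRT : R ∈ T := hTc.csSup_mem ⟨0, hT0⟩ hTb
  have hb : o + R • θ ∈ G := hRT
  have hout : ∀ r, R < r → o + r • θ ∉ G := fun r hr hmem => (le_csSup hTb hmem).not_gt hr
  have hbint : o + R • θ ∉ interior G := by
    intro hmem
    have : ∀ᶠ r in nhds R, o + r • θ ∈ interior G :=
      hray.continuousAt.eventually (isOpen_interior.mem_nhds hmem)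
    obtain ⟨ε, hε, hball⟩ := Metric.eventually_nhds_iff.1 this
    refine hout (R + ε / 2) (by linarith) (interior_subset (hball ?_))
    rw [Real.dist_eq, add_sub_cancel_left, abs_of_pos (by positivity)]
    linarith
  obtain ⟨f, hf⟩ := geometric_hahn_banach_open_point hconv.interior isOpen_interior hbint
  have hf0 : f ≠ 0 := by
    rintro rfl
    obtain ⟨y, hy⟩ := hint
    simpa using hf y hy
  have hfG : ∀ y ∈ G, f y ≤ f (o + R • θ) := by
    intro y hy
    have hy' : y ∈ closure (interior G) := by
      rw [hconv.closure_interior_eq_closure_of_nonempty_interior hint]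
      exact subset_closure hy
    exact closure_minimal (fun z hz => (hf z hz).le)
      (isClosed_le f.continuous continuous_const) hy'
  refine ⟨R, fun r hr0 => ⟨fun hr => ?_, fun hr => ?_⟩⟩
  · exact indicator_of_notMem (fun hmem => hout r hr hmem.1) _
  · have hR0 : 0 < R := hr0.trans hr
    by_cases hmem : r • θ ∈ (o + ·) ⁻¹' {x ∈ G | ¬ IsDeep G s x}
    swap
    · rw [indicator_of_notMem hmem]; exact zero_le
    rw [indicator_of_mem hmem]
    have ha0 : 0 ≤ 1 - r / R := by rw [sub_nonneg, div_le_one hR0]; exact hr.le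
    have ha1 : 1 - r / R ≤ 1 := by have : 0 ≤ r / R := by positivity
                                   linarith
    have hx : (o + R • θ) + (1 - r / R) • (o - (o + R • θ)) = o + r • θ := by
      have : r • θ = (r / R * R) • θ := by rw [div_mul_cancel₀ _ hR0.ne']
      rw [this]; module
    have hx' : (o + R • θ) + (c * (1 - r / R)) • (o - (o + R • θ)) =
        o + ((1 - c) * R + c * r) • θ := by
      have : (c * r) • θ = (c * (r / R * R)) • θ := by rw [div_mul_cancel₀ _ hR0.ne']
      rw [add_smul _ (c * r), this]; module
    have hmem' : o + ((1 - c) * R + c * r) • θ ∈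
        {x ∈ G | ¬ IsDeep G (growthConst d * c * s) x} := ?_
    · rw [indicator_of_mem (mem_preimage.2 hmem')]
      exact le_rfl
    refine ⟨?_, ?_⟩
    · rw [← hx']
      exact hconv.add_smul_sub_mem hb ho ⟨by positivity, by nlinarith⟩
    · rintro ⟨-, e, he, hse⟩
      rw [← hx'] at he
      obtain ⟨e', he', hle⟩ := exists_cross_of_cross_contraction hd hconv hb ho he₀ hmax hf0 hfG
        hc0 hc ha0 ha1 he
      rw [hx] at he'
      refine hmem.2 ⟨hmem.1, e', he', ?_⟩
      exact le_of_mul_le_mul_left (hse.trans hle) (by positivity)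

end Growth

section RandomPolytope

variable {d n : ℕ} {G : Set (Euc d)}

theorem convexHull_range_eq_image_stdSimplex {E ι : Type*} [AddCommGroup E] [Module ℝ E]
    [Fintype ι] (v : ι → E) :
    convexHull ℝ (range v) = (fun w : ι → ℝ => ∑ i, w i • v i) '' stdSimplex ℝ ι := by
  classical
  have h := (Fintype.linearCombination ℝ v).image_convexHull
    (range fun i : ι => (Pi.single i 1 : ι → ℝ))
  rw [convexHull_rangle_single_eq_stdSimplex, ← range_comp] at h
  convert h.symm using 2
  · congr 1
    ext i
    simp
  · exact (Fintype.linearCombination_apply ..).symm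

theorem isClosed_setOf_mem_convexHull_range :
    IsClosed {p : (Fin n → Euc d) × Euc d | p.2 ∈ convexHull ℝ (range p.1)} := by
  have : CompactSpace (stdSimplex ℝ (Fin n)) :=
    isCompact_iff_compactSpace.mp (isCompact_stdSimplex ℝ (Fin n))
  have hcl : IsClosed {q : stdSimplex ℝ (Fin n) × ((Fin n → Euc d) × Euc d) |
      ∑ i, (q.1 : Fin n → ℝ) i • q.2.1 i = q.2.2} := by
    refine isClosed_eq ?_ (by fun_prop)
    refine continuous_finsetSum _ fun i _ => ?_
    exact ((continuous_apply i).comp (continuous_subtype_val.comp continuous_fst)).smul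
      (by fun_prop)
  convert isClosedMap_snd_of_compactSpace _ hcl using 1
  ext ⟨ω, x⟩
  simp only [convexHull_range_eq_image_stdSimplex]
  exact ⟨fun ⟨w, hw, h⟩ => ⟨(⟨w, hw⟩, ω, x), h, rfl⟩,
    by rintro ⟨⟨w, _⟩, h, rfl⟩; exact ⟨w, w.2, h⟩⟩

theorem unifMeasure_eq_restrict (hG : volume G = 1) : unifMeasure G = volume.restrict G := by
  simp [unifMeasure, hG]

theorem isProbabilityMeasure_unifMeasure (hG : volume G = 1) :
    IsProbabilityMeasure (unifMeasure G) :=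
  ⟨by simp [unifMeasure_eq_restrict hG, hG]⟩

theorem isProbabilityMeasure_sampleMeasure (hG : volume G = 1) :
    IsProbabilityMeasure (sampleMeasure G n) := by
  have := isProbabilityMeasure_unifMeasure hG
  rw [sampleMeasure]
  infer_instance

theorem sampleMeasure_forall_notMem (hG : volume G = 1) {A : Set (Euc d)} (hA : MeasurableSet A) :
    sampleMeasure G n {ω | ∀ j, ω j ∉ A} = (1 - volume (G ∩ A)) ^ n := by
  have := isProbabilityMeasure_unifMeasure hG
  have h : {ω : Fin n → Euc d | ∀ j, ω j ∉ A} = univ.pi fun _ => Aᶜ := by ext; simp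
  rw [h, sampleMeasure, Measure.pi_pi, Finset.prod_const, prob_compl_eq_one_sub hA,
    unifMeasure_eq_restrict hG, Measure.restrict_apply hA, inter_comm]
  simp

/-- The probability that `x` is not covered by the convex hull of the sample. -/
def missProb (G : Set (Euc d)) (n : ℕ) (x : Euc d) : ℝ≥0∞ :=
  sampleMeasure G n {ω | x ∉ convexHull ℝ (range ω)}

theorem missProb_le_one (hG : volume G = 1) (x : Euc d) : missProb G n x ≤ 1 := by
  have := isProbabilityMeasure_sampleMeasure (n := n) hG
  exact prob_le_one

theorem measurableSet_setOf_notMem_convexHull_range :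
    MeasurableSet {p : (Fin n → Euc d) × Euc d | p.2 ∉ convexHull ℝ (range p.1)} :=
  isClosed_setOf_mem_convexHull_range.measurableSet.compl

theorem measurable_missProb (hG : volume G = 1) : Measurable (missProb G n) := by
  have := isProbabilityMeasure_sampleMeasure (n := n) hG
  exact measurable_measure_prodMk_right (μ := sampleMeasure G n)
    measurableSet_setOf_notMem_convexHull_range

theorem expected_missing_volume_eq (hG : volume G = 1) :
    ∫ ω, (volume (G \ convexHull ℝ (range ω))).toReal ∂(sampleMeasure G n) =
      (∫⁻ x in G, missProb G n x).toReal := by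
  have := isProbabilityMeasure_sampleMeasure (n := n) hG
  have hsec (ω : Fin n → Euc d) : volume (G \ convexHull ℝ (range ω)) =
      volume.restrict G (Prod.mk ω ⁻¹' {p | p.2 ∉ convexHull ℝ (range p.1)}) := by
    rw [Measure.restrict_apply
      (measurable_prodMk_left measurableSet_setOf_notMem_convexHull_range), inter_comm]
    rfl
  have hmeas : Measurable fun ω : Fin n → Euc d => volume (G \ convexHull ℝ (range ω)) := by
    simp_rw [hsec]
    exact measurable_measure_prodMk_left measurableSet_setOf_notMem_convexHull_range
  rw [integral_toReal hmeas.aemeasurable]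
  · congr 1
    simp_rw [hsec]
    rw [← Measure.prod_apply measurableSet_setOf_notMem_convexHull_range,
      Measure.prod_apply_symm measurableSet_setOf_notMem_convexHull_range]
    rfl
  · exact .of_forall fun ω => (measure_mono sdiff_subset).trans_lt (hG ▸ ENNReal.one_lt_top)

theorem lintegral_missProb_le_one (hG : volume G = 1) : ∫⁻ x in G, missProb G n x ≤ 1 :=
  (setLIntegral_mono measurable_const fun x _ => missProb_le_one hG x).trans (by simp [hG])

theorem exp_neg_two_le_one_sub_inv_pow (hn : 2 ≤ n) :
    Real.exp (-2) ≤ (1 - 1 / (n : ℝ)) ^ n := by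
  have hn' : (2 : ℝ) ≤ n := by exact_mod_cast hn
  have ht0 : 0 < 1 / (n : ℝ) := by positivity
  have ht : 1 / (n : ℝ) ≤ 1 / 2 := one_div_le_one_div_of_le two_pos hn'
  have hnt : (n : ℝ) * (1 / n) = 1 := by field_simp
  set t := 1 / (n : ℝ)
  have h1 : Real.exp (-(2 * t)) ≤ 1 - t := by
    rw [Real.exp_neg]
    refine inv_le_of_inv_le₀ (by linarith) (le_trans ?_ (Real.add_one_le_exp (2 * t)))
    rw [inv_le_iff_one_le_mul₀ (by linarith)]
    nlinarith
  calc Real.exp (-2) = Real.exp (-(2 * t)) ^ n := by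
        rw [← Real.exp_nat_mul]
        congr 1
        linear_combination 2 * hnt
    _ ≤ _ := by gcongr

theorem le_missProb_of_mem_wetPart (hG : volume G = 1) (hn : 2 ≤ n) {x : Euc d}
    (hx : x ∈ wetPart G (1 / n)) : ENNReal.ofReal (Real.exp (-2)) ≤ missProb G n x := by
  obtain ⟨-, u, c, -, hc, hvol⟩ := hx
  rw [hG, mul_one] at hvol
  have hn' : (1 : ℝ) ≤ n := by exact_mod_cast (by omega : 1 ≤ n)
  have hH : IsClosed {y : Euc d | c ≤ ⟪u, y⟫} := isClosed_le continuous_const (by fun_prop)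
  calc ENNReal.ofReal (Real.exp (-2)) ≤ ENNReal.ofReal ((1 - 1 / (n : ℝ)) ^ n) :=
        ENNReal.ofReal_le_ofReal (exp_neg_two_le_one_sub_inv_pow hn)
    _ = (1 - ENNReal.ofReal (1 / n)) ^ n := by
        rw [ENNReal.ofReal_pow (sub_nonneg.2 (by rw [div_le_one] <;> linarith)),
          ENNReal.ofReal_sub _ (by positivity), ENNReal.ofReal_one]
    _ ≤ (1 - volume (G ∩ {y | c ≤ ⟪u, y⟫})) ^ n := by gcongr
    _ = sampleMeasure G n {ω | ∀ j, ω j ∉ {y | c ≤ ⟪u, y⟫}} :=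
        (sampleMeasure_forall_notMem hG hH.measurableSet).symm
    _ ≤ missProb G n x := by
        refine measure_mono fun ω hω hx => ?_
        have hconv : Convex ℝ {y : Euc d | ⟪u, y⟫ < c} :=
          convex_halfSpace_lt (innerₗ (Euc d) u).isLinear c
        have hω' : range ω ⊆ {y | ⟪u, y⟫ < c} :=
          range_subset_iff.2 fun j => show ⟪u, ω j⟫ < c from not_le.1 (hω j)
        exact not_lt.2 hc (convexHull_min hω' hconv hx)

theorem mul_volume_wetPart_le (hG : volume G = 1) (hGm : MeasurableSet G) (hn : 2 ≤ n) :
    ENNReal.ofReal (Real.exp (-2)) * volume (wetPart G (1 / n)) ≤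
      ∫⁻ x in G, missProb G n x := by
  refine le_trans ?_ (mul_meas_ge_le_lintegral (measurable_missProb hG)
    (ENNReal.ofReal (Real.exp (-2))))
  rw [Measure.restrict_apply' hGm]
  gcongr
  exact fun x hx => ⟨le_missProb_of_mem_wetPart hG hn hx, hx.1⟩

theorem exists_sign_forall_notMem {x : Euc d} {e : Fin d → Euc d} {ω : Fin n → Euc d}
    (hω : x ∉ convexHull ℝ (range ω)) : ∃ σ : Fin d → Bool,
      ∀ j, ω j - x ∉ parallelepiped fun i => ((d : ℝ)⁻¹ * cond (σ i) 1 (-1)) • e i := by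
  obtain ⟨f, c, hfx, hf⟩ := geometric_hahn_banach_point_closed (convex_convexHull ℝ (range ω))
    ((finite_range ω).isCompact_convexHull ℝ).isClosed hω
  refine ⟨fun i => decide (f (e i) ≤ 0), fun j hj => ?_⟩
  obtain ⟨t, ht, htj⟩ := (mem_parallelepiped_iff _ _).1 hj
  have h1 : f (ω j - x) ≤ 0 := by
    rw [htj, map_sum]
    refine Finset.sum_nonpos fun i _ => ?_
    rw [map_smul, map_smul, smul_eq_mul, smul_eq_mul]
    refine mul_nonpos_of_nonneg_of_nonpos (ht.1 i) ?_
    rw [mul_assoc]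
    refine mul_nonpos_of_nonneg_of_nonpos (by positivity) ?_
    by_cases h : f (e i) ≤ 0
    · simp [h]
    · simpa [h] using (not_le.1 h).le
  have h2 := hf _ (subset_convexHull ℝ _ (mem_range_self j))
  rw [map_sub] at h1
  linarith

theorem setOf_sub_mem_parallelepiped_subset (hd : 1 ≤ d) (hconv : Convex ℝ G) {x : Euc d}
    (hx : x ∈ G) {e : Fin d → Euc d} (he : e ∈ crossFamilies G x) (σ : Fin d → Bool) :
    {y | y - x ∈ parallelepiped fun i => ((d : ℝ)⁻¹ * cond (σ i) 1 (-1)) • e i} ⊆ G := by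
  intro y hy
  obtain ⟨t, ht, hty⟩ := (mem_parallelepiped_iff _ _).1 hy
  have hd0 : (d : ℝ) ≠ 0 := by exact_mod_cast (by omega : d ≠ 0)
  have hmem (i : Fin d) : x + (t i * cond (σ i) 1 (-1)) • e i ∈ G := by
    cases σ i
    · have := hconv.add_smul_sub_mem hx (he i).2 (⟨ht.1 i, ht.2 i⟩ : t i ∈ Icc 0 1)
      convert this using 2
      simp
    · have := hconv.add_smul_sub_mem hx (he i).1 (⟨ht.1 i, ht.2 i⟩ : t i ∈ Icc 0 1)
      convert this using 2
      simp
  have := hconv.sum_mem (t := Finset.univ) (w := fun _ : Fin d => (d : ℝ)⁻¹)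
    (fun _ _ => by positivity) (by simp [hd0]) (fun i _ => hmem i)
  convert this
  rw [← sub_add_cancel y x, hty]
  simp only [smul_add, Finset.sum_add_distrib, Finset.sum_const, Finset.card_univ, Fintype.card_fin]
  rw [← Nat.cast_smul_eq_nsmul ℝ, smul_smul, mul_inv_cancel₀ hd0, one_smul, add_comm]
  congr 1
  refine Finset.sum_congr rfl fun i _ => ?_
  rw [smul_smul, smul_smul]
  ring_nf

theorem volume_setOf_sub_mem_parallelepiped (x : Euc d) (e : Fin d → Euc d) (σ : Fin d → Bool) :
    volume {y | y - x ∈ parallelepiped fun i => ((d : ℝ)⁻¹ * cond (σ i) 1 (-1)) • e i} =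
      ENNReal.ofReal ((d : ℝ)⁻¹ ^ d * |stdDet e|) := by
  have h : (fun y => y + -x) ⁻¹'
      (parallelepiped fun i => ((d : ℝ)⁻¹ * cond (σ i) 1 (-1)) • e i) =
      {y | y - x ∈ parallelepiped fun i => ((d : ℝ)⁻¹ * cond (σ i) 1 (-1)) • e i} := by
    simp only [← sub_eq_add_neg]
    rfl
  rw [← h, measure_preimage_add_right, volume_parallelepiped_eq]
  simp only [mul_smul]
  rw [stdDet_smul, abs_mul, abs_stdDet_signs (fun i => by cases σ i <;> simp),
    abs_of_nonneg (by positivity)]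

theorem measurableSet_parallelepiped (v : Fin d → Euc d) : MeasurableSet (parallelepiped v) :=
  (isCompact_Icc.image (by fun_prop)).measurableSet

theorem missProb_le_of_isDeep (hd : 1 ≤ d) (hconv : Convex ℝ G) (hG : volume G = 1) {s : ℝ}
    {x : Euc d} (hx : IsDeep G s x) :
    missProb G n x ≤ 2 ^ d * ENNReal.ofReal (Real.exp (-(n * ((d : ℝ)⁻¹ ^ d * s)))) := by
  obtain ⟨hxG, e, he, hse⟩ := hx
  set A : (Fin d → Bool) → Set (Euc d) := fun σ =>
    {y | y - x ∈ parallelepiped fun i => ((d : ℝ)⁻¹ * cond (σ i) 1 (-1)) • e i}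
  have hA (σ) : sampleMeasure G n {ω | ∀ j, ω j ∉ A σ} ≤
      ENNReal.ofReal (Real.exp (-(n * ((d : ℝ)⁻¹ ^ d * s)))) := by
    have hle : ENNReal.ofReal ((d : ℝ)⁻¹ ^ d * s) ≤ volume (G ∩ A σ) := by
      rw [inter_eq_right.2 (setOf_sub_mem_parallelepiped_subset hd hconv hxG he σ),
        volume_setOf_sub_mem_parallelepiped]
      gcongr
    have hAm : MeasurableSet (A σ) := (measurable_sub_const x) (measurableSet_parallelepiped _)
    rw [sampleMeasure_forall_notMem hG hAm]
    calc (1 - volume (G ∩ A σ)) ^ n ≤ (1 - ENNReal.ofReal ((d : ℝ)⁻¹ ^ d * s)) ^ n := by gcongr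
      _ ≤ ENNReal.ofReal (Real.exp (-((d : ℝ)⁻¹ ^ d * s))) ^ n := by
          gcongr
          rw [tsub_le_iff_right, ← ENNReal.ofReal_one]
          refine le_trans (ENNReal.ofReal_le_ofReal ?_) ENNReal.ofReal_add_le
          linarith [Real.add_one_le_exp (-((d : ℝ)⁻¹ ^ d * s))]
      _ = _ := by
          rw [← ENNReal.ofReal_pow (Real.exp_nonneg _), ← Real.exp_nat_mul, mul_neg]
  calc missProb G n x ≤ sampleMeasure G n (⋃ σ, {ω | ∀ j, ω j ∉ A σ}) :=
        measure_mono fun ω hω => mem_iUnion.2 (exists_sign_forall_notMem hω)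
    _ ≤ ∑ σ, sampleMeasure G n {ω | ∀ j, ω j ∉ A σ} := measure_iUnion_fintype_le _ _
    _ ≤ ∑ _σ : Fin d → Bool, ENNReal.ofReal (Real.exp (-(n * ((d : ℝ)⁻¹ ^ d * s)))) :=
        Finset.sum_le_sum fun σ _ => hA σ
    _ = _ := by simp

theorem exists_not_isDeep_of_missProb_le (hd : 1 ≤ d) (hGb : IsConvexBody G) (hG : volume G = 1)
    {s : ℝ} (hs : 0 < s) (x : Euc d) : ∃ k : ℕ, ¬ IsDeep G ((k + 1) * s) x ∧
      missProb G n x ≤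
        2 ^ d * ENNReal.ofReal (Real.exp (-(n * ((d : ℝ)⁻¹ ^ d * (k * s))))) := by
  classical
  obtain ⟨o, -, e, -, hmax⟩ := exists_max_cross hGb.1 (hGb.2.2.mono interior_subset)
  have hex : ∃ k : ℕ, ¬ IsDeep G ((k + 1) * s) x := by
    obtain ⟨k, hk⟩ := exists_nat_gt (|stdDet e| / s)
    rw [div_lt_iff₀ hs] at hk
    refine ⟨k, fun ⟨hx, e', he', hs'⟩ => ?_⟩
    have := hmax x hx e' he'
    linarith
  refine ⟨Nat.find hex, Nat.find_spec hex, ?_⟩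
  rcases hk : Nat.find hex with _ | k
  · refine (missProb_le_one hG x).trans ?_
    simpa using one_le_pow₀ (M₀ := ℝ≥0∞) one_le_two
  · have hdeep := not_not.1 (Nat.find_min hex (m := k) (by omega))
    rw [Nat.cast_succ]
    exact missProb_le_of_isDeep hd hGb.2.1 hG hdeep

theorem growthConst_ge (hd : 1 ≤ d) : 8 ≤ growthConst d := by
  have hd' : (1 : ℝ) ≤ d := by exact_mod_cast hd
  have : (2 : ℝ) ^ 3 ≤ 2 ^ (2 * d + 1) := pow_le_pow_right₀ one_le_two (by omega)
  rw [growthConst]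
  nlinarith

theorem volume_not_isDeep_mul_le (hd : 1 ≤ d) (hGb : IsConvexBody G) (s : ℝ) (k : ℕ) :
    volume {x ∈ G | ¬ IsDeep G ((k + 1) * s) x} ≤
      ENNReal.ofReal (growthConst d * (k + 1)) * volume {x ∈ G | ¬ IsDeep G s x} := by
  have hK := growthConst_ge hd
  have hK0 : 0 < growthConst d * (k + 1) := by positivity
  have h := mul_volume_not_isDeep_le hd hGb ((k + 1) * s) (c := (growthConst d * (k + 1))⁻¹)
    (by positivity) (by
      rw [one_div]
      refine inv_anti₀ four_pos ?_
      have : (0 : ℝ) ≤ k := by positivity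
      nlinarith)
  have hs : growthConst d * (growthConst d * (k + 1))⁻¹ * ((k + 1) * s) = s := by
    have : (k : ℝ) + 1 ≠ 0 := by positivity
    field_simp
  rw [hs, ENNReal.ofReal_inv_of_pos hK0] at h
  rwa [← ENNReal.inv_mul_le_iff] <;> simp [hK0]

theorem lintegral_missProb_le (hd : 1 ≤ d) (hGb : IsConvexBody G) (hG : volume G = 1)
    {s : ℝ} (hs : 0 < s) :
    ∫⁻ x in G, missProb G n x ≤
      (∑' k : ℕ, ENNReal.ofReal (2 ^ d * Real.exp (-(n * ((d : ℝ)⁻¹ ^ d * (k * s)))) *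
        (growthConst d * (k + 1)))) * volume {x ∈ G | ¬ IsDeep G s x} := by
  set a : ℕ → ℝ := fun k => 2 ^ d * Real.exp (-(n * ((d : ℝ)⁻¹ ^ d * (k * s))))
  set B : ℕ → Set (Euc d) := fun k => {x | ¬ IsDeep G ((k + 1) * s) x}
  have hB (k) : MeasurableSet (B k) := (isClosed_setOf_isDeep hGb.1 _).measurableSet.compl
  calc ∫⁻ x in G, missProb G n x
      ≤ ∫⁻ x in G, ∑' k, (B k).indicator (fun _ => ENNReal.ofReal (a k)) x := by
        refine lintegral_mono fun x => ?_
        obtain ⟨k, hk, hle⟩ := exists_not_isDeep_of_missProb_le (n := n) hd hGb hG hs x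
        refine le_trans ?_ (ENNReal.le_tsum k)
        rw [indicator_of_mem hk, ENNReal.ofReal_mul (by positivity)]
        simpa [ENNReal.ofReal_pow] using hle
    _ = ∑' k, ENNReal.ofReal (a k) * volume {x ∈ G | ¬ IsDeep G ((k + 1) * s) x} := by
        rw [lintegral_tsum fun k => (measurable_const.indicator (hB k)).aemeasurable]
        refine tsum_congr fun k => ?_
        rw [lintegral_indicator_const (hB k), Measure.restrict_apply (hB k), inter_comm]
        rfl
    _ ≤ ∑' k : ℕ, ENNReal.ofReal (a k * (growthConst d * (k + 1))) *
          volume {x ∈ G | ¬ IsDeep G s x} := by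
        refine ENNReal.tsum_le_tsum fun k => ?_
        rw [ENNReal.ofReal_mul (p := a k) (by positivity), mul_assoc]
        gcongr
        exact volume_not_isDeep_mul_le hd hGb s k
    _ = _ := ENNReal.tsum_mul_right

theorem volume_not_isDeep_le_wetPart (hd : 1 ≤ d) (hGb : IsConvexBody G) (hG : volume G = 1)
    {s : ℝ} : volume {x ∈ G | ¬ IsDeep G s x} ≤ volume (wetPart G ((4 * d) ^ d * s)) := by
  calc volume {x ∈ G | ¬ IsDeep G s x}
      ≤ volume (wetPart G ((4 * d) ^ d * s) ∪ frontier G) := by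
        refine measure_mono fun x ⟨hx, hdeep⟩ => ?_
        by_cases hint : x ∈ interior G
        · refine Or.inl ⟨hx, ?_⟩
          simpa only [hG, mul_one] using exists_cap_volume_lt hd hGb.1 hGb.2.1 hint hdeep
        · exact Or.inr ⟨subset_closure hx, hint⟩
    _ ≤ volume (wetPart G ((4 * d) ^ d * s)) + volume (frontier G) := measure_union_le _ _
    _ = _ := by rw [hGb.2.1.addHaar_frontier volume, add_zero]

/-- The dimensional constant of the upper bound, as the sum of this series. -/
def missSeries (d k : ℕ) : ℝ :=
  2 ^ d * Real.exp (-((d : ℝ)⁻¹ ^ d * ((4 * d : ℝ) ^ d)⁻¹ * k)) * (growthConst d * (k + 1))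

theorem missSeries_pos (hd : 1 ≤ d) (k : ℕ) : 0 < missSeries d k := by
  have := growthConst_ge hd
  rw [missSeries]
  positivity

theorem summable_missSeries (hd : 1 ≤ d) : Summable (missSeries d) := by
  have hd' : (0 : ℝ) < d := by exact_mod_cast hd
  set r : ℝ := (d : ℝ)⁻¹ ^ d * ((4 * d : ℝ) ^ d)⁻¹
  have hr : 0 < r := by positivity
  have h0 := Real.summable_exp_nat_mul_iff.2 (neg_lt_zero.2 hr)
  have h1 := Real.summable_pow_mul_exp_neg_nat_mul 1 hr
  have h := ((h1.add h0).mul_left (2 ^ d * growthConst d))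
  refine h.congr fun k => ?_
  simp only [missSeries]
  rw [pow_one, mul_comm (k : ℝ) (-r), neg_mul]
  ring

theorem lintegral_missProb_le_wetPart (hd : 1 ≤ d) (hGb : IsConvexBody G) (hG : volume G = 1)
    (hn : n ≠ 0) :
    ∫⁻ x in G, missProb G n x ≤
      ENNReal.ofReal (∑' k, missSeries d k) * volume (wetPart G (1 / n)) := by
  have hd' : (0 : ℝ) < d := by exact_mod_cast hd
  have hn' : (0 : ℝ) < n := by positivity
  have hwet : (4 * d : ℝ) ^ d * (((4 * d : ℝ) ^ d)⁻¹ / n) = 1 / n := by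
    field_simp
  have h := (lintegral_missProb_le (n := n) hd hGb hG
    (s := ((4 * d : ℝ) ^ d)⁻¹ / n) (by positivity)).trans
      (mul_le_mul_right (volume_not_isDeep_le_wetPart hd hGb hG) _)
  rw [hwet] at h
  rw [ENNReal.ofReal_tsum_of_nonneg (fun k => (missSeries_pos hd k).le) (summable_missSeries hd)]
  have hterm (k : ℕ) : missSeries d k = 2 ^ d * Real.exp (-(n * ((d : ℝ)⁻¹ ^ d *
      (k * (((4 * d : ℝ) ^ d)⁻¹ / n))))) * (growthConst d * (k + 1)) := by
    rw [missSeries]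
    congr 4
    field_simp
  simpa only [hterm] using h

end RandomPolytope

/-- **Bárány–Larman**: for a convex body `G` of volume one, the expected missing volume of the
convex hull of `n` i.i.d. uniform points is comparable to the volume of the `(1/n)`-wet part,
with a universal lower constant `c₁` and a dimensional upper constant `c₂(d)`, for `n ≥ n₀(d)`. -/
theorem expected_missing_volume_comparable_wet_part :
    ∃ c1 : ℝ, 0 < c1 ∧
      ∀ d : ℕ, 1 ≤ d →
        ∃ (c2 : ℝ) (n0 : ℕ), 0 < c2 ∧
          ∀ G : Set (Euc d), IsConvexBody G → volume G = 1 →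
            ∀ n : ℕ, n0 ≤ n →
              c1 * (volume (wetPart G (1 / (n : ℝ)))).toReal ≤
                  (∫ ω, (volume (G \ convexHull ℝ (Set.range ω))).toReal
                    ∂(sampleMeasure G n)) ∧
                (∫ ω, (volume (G \ convexHull ℝ (Set.range ω))).toReal
                    ∂(sampleMeasure G n)) ≤
                  c2 * (volume (wetPart G (1 / (n : ℝ)))).toReal := by
  refine ⟨Real.exp (-2), Real.exp_pos _, fun d hd => ⟨∑' k, missSeries d k, 2,
    (summable_missSeries hd).tsum_pos (fun k => (missSeries_pos hd k).le) 0 (missSeries_pos hd 0),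
    fun G hGb hG n hn => ?_⟩⟩
  have hwet : volume (wetPart G (1 / (n : ℝ))) ≠ ∞ :=
    ne_top_of_le_ne_top (hG ▸ ENNReal.one_ne_top) (measure_mono fun x hx => hx.1)
  have hC : 0 ≤ ∑' k, missSeries d k := tsum_nonneg fun k => (missSeries_pos hd k).le
  rw [expected_missing_volume_eq hG]
  constructor
  · rw [← ENNReal.toReal_ofReal (Real.exp_nonneg (-2)), ← ENNReal.toReal_mul]
    exact ENNReal.toReal_mono
      (ne_top_of_le_ne_top ENNReal.one_ne_top (lintegral_missProb_le_one hG))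
      (mul_volume_wetPart_le hG hGb.1.measurableSet hn)
  · nth_rw 1 [← ENNReal.toReal_ofReal hC]
    rw [← ENNReal.toReal_mul]
    exact ENNReal.toReal_mono (ENNReal.mul_ne_top ENNReal.ofReal_ne_top hwet)
      (lintegral_missProb_le_wetPart hd hGb hG (by omega))
end
end

section
/- Let d ≥ 1. There exists a constant C(d) > 0 such that for every integer n ≥ 1 and every convex body G ⊆ ℝ^d, if X_1, …, X_n are i.i.d. points uniformly distributed in G and K̂_n is their convex hull, then E_G[|G △ K̂_n| / |G|] ≤ C(d)·n^{-2/(d+1)}, where since K̂_n ⊆ G almost surely the symmetric difference G △ K̂_n equals G \ K̂_n. -/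
open MeasureTheory Metric Set
open scoped RealInnerProductSpace ENNReal symmDiff

noncomputable section

/-- A continuous, nonnegative sublinear function with compact sublevel sets, such as the gauge of
a convex body containing the origin in its interior. -/
structure IsConvexGauge {E : Type*} [NormedAddCommGroup E] [NormedSpace ℝ E] (p : E → ℝ) :
    Prop where
  add_le : ∀ x y, p (x + y) ≤ p x + p y
  map_smul : ∀ c : ℝ, 0 ≤ c → ∀ x, p (c • x) = c * p x
  nonneg : ∀ x, 0 ≤ p x
  continuous : Continuous p
  isCompact : IsCompact {x | p x ≤ 1}

namespace IsConvexGauge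

section General

variable {E : Type*} [NormedAddCommGroup E] [NormedSpace ℝ E] {p : E → ℝ}

theorem sublevel_eq (hp : IsConvexGauge p) {r : ℝ} (hr : 0 < r) :
    {x | p x ≤ r} = (fun x => r • x) '' {x | p x ≤ 1} := by
  ext x
  constructor
  · intro hx
    refine ⟨r⁻¹ • x, ?_, by simp [smul_smul, hr.ne']⟩
    have hx' : p x ≤ r := hx
    change p (r⁻¹ • x) ≤ 1
    rw [hp.map_smul _ (by positivity), inv_mul_le_iff₀ hr]
    linarith
  · rintro ⟨y, hy, rfl⟩
    have hy' : p y ≤ 1 := hy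
    change p (r • y) ≤ r
    rw [hp.map_smul _ hr.le]
    nlinarith

theorem isCompact_sublevel (hp : IsConvexGauge p) {r : ℝ} (hr : 0 < r) :
    IsCompact {x | p x ≤ r} := by
  rw [hp.sublevel_eq hr]
  exact hp.isCompact.image (by fun_prop)

theorem abs_sub_le (hp : IsConvexGauge p) {x h : E} {a : ℝ} (h₁ : p h ≤ a) (h₂ : p (-h) ≤ a) :
    |p (x + h) - p x| ≤ a := by
  have := hp.add_le x h
  have := hp.add_le (x + h) (-h)
  rw [add_neg_cancel_right] at this
  rw [abs_le]
  constructor <;> linarith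

theorem secondDiff_nonneg (hp : IsConvexGauge p) (x h : E) :
    0 ≤ p (x + h) + p (x - h) - 2 * p x := by
  have h1 := hp.add_le (x + h) (x - h)
  have h2 : x + h + (x - h) = (2 : ℝ) • x := by rw [two_smul]; abel
  rw [h2, hp.map_smul _ (by norm_num)] at h1
  linarith

/-- Second differences of a convex function along a line are monotone in the step. -/
theorem secondDiff_mono (hp : IsConvexGauge p) (x h : E) {t : ℝ} (ht0 : 0 ≤ t) (ht : t ≤ 1) :
    p (x + t • h) + p (x - t • h) - 2 * p x ≤ p (x + h) + p (x - h) - 2 * p x := by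
  have key : ∀ v : E, p (x + t • v) ≤ (1 - t) * p x + t * p (x + v) := by
    intro v
    have h1 := hp.add_le ((1 - t) • x) (t • (x + v))
    rw [hp.map_smul _ (by linarith), hp.map_smul _ ht0] at h1
    have h2 : (1 - t) • x + t • (x + v) = x + t • v := by module
    rwa [h2] at h1
  have h1 := key h
  have h2 := key (-h)
  rw [smul_neg, ← sub_eq_add_neg, ← sub_eq_add_neg] at h2
  nlinarith [hp.secondDiff_nonneg x h]

theorem exists_support (hp : IsConvexGauge p) (x : E) :
    ∃ l : E →ₗ[ℝ] ℝ, l x = p x ∧ ∀ y, l y ≤ p y := by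
  have hp0 : p 0 = 0 := by simpa using hp.map_smul 0 le_rfl 0
  by_cases hx : x = 0
  · exact ⟨0, by simp [hx, hp0], fun y => by simpa using hp.nonneg y⟩
  obtain ⟨g, hg1, hg2⟩ := exists_extension_of_le_sublinear
    (LinearPMap.mkSpanSingleton (K := ℝ) x (p x) hx) p
    (fun c hc y => hp.map_smul c hc.le y) hp.add_le (by
      rintro ⟨y, hy⟩
      obtain ⟨c, rfl⟩ := Submodule.mem_span_singleton.1 hy
      rw [LinearPMap.mkSpanSingleton'_apply, RingHom.id_apply, smul_eq_mul]
      rcases le_or_gt 0 c with hc | hc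
      · exact (hp.map_smul c hc x).ge
      · exact (mul_nonpos_of_nonpos_of_nonneg hc.le (hp.nonneg x)).trans (hp.nonneg _))
  refine ⟨g, ?_, hg2⟩
  rw [hg1 ⟨x, Submodule.mem_span_singleton_self x⟩]
  exact LinearPMap.mkSpanSingleton'_apply_self _ _ _ _

end General

section Measure

variable {E : Type*} [NormedAddCommGroup E] [NormedSpace ℝ E]
  [MeasurableSpace E] [BorelSpace E] (μ : Measure E) [μ.IsAddHaarMeasure] {p : E → ℝ}

/-- The integral of a second difference of a sublinear function is quadratic in the step. -/
theorem lintegral_secondDiff_le (hp : IsConvexGauge p) {h : E} {a : ℝ} (h₁ : p h ≤ a)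
    (h₂ : p (-h) ≤ a) (ha : a ≤ 1) :
    ∫⁻ x in {x | p x ≤ 2}, ENNReal.ofReal (p (x + h) + p (x - h) - 2 * p x) ∂μ ≤
      ENNReal.ofReal (a ^ 2) * μ {x | p x ≤ 4} := by
  have hpc := hp.continuous
  have ha0 : 0 ≤ a := (hp.nonneg _).trans h₁
  set φ : E → ℝ := fun x => max 0 (3 - p x) with hφ
  have hφc : Continuous φ := by fun_prop
  have hφ0 : ∀ x, 3 < p x → φ x = 0 := fun x hx => max_eq_left (by linarith)
  have hint : ∀ u : E → ℝ, Continuous u → Integrable (fun x => u x * φ x) μ := by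
    intro u hu
    refine (hu.mul hφc).integrable_of_hasCompactSupport ?_
    refine HasCompactSupport.intro (hp.isCompact_sublevel (r := 3) (by norm_num)) ?_
    intro x hx
    simp only [mem_ofPred_eq, not_le] at hx
    simp [hφ0 x hx]
  have i1 := hint (fun x => p (x + h) - p x) (by fun_prop)
  have i2 := hint (fun x => p x - p (x - h)) (by fun_prop)
  have i2' := i2.comp_add_right h
  have hfin : μ {x | p x ≤ 4} ≠ ⊤ := (hp.isCompact_sublevel (by norm_num)).measure_lt_top.ne
  have hmeas : ∀ r : ℝ, MeasurableSet {x | p x ≤ r} := fun r =>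
    (isClosed_le hpc continuous_const).measurableSet
  have hle : ∫ x, (p (x + h) + p (x - h) - 2 * p x) * φ x ∂μ ≤ a ^ 2 * μ.real {x | p x ≤ 4} := by
    calc ∫ x, (p (x + h) + p (x - h) - 2 * p x) * φ x ∂μ
        = ∫ x, (p (x + h) - p x) * φ x ∂μ - ∫ x, (p x - p (x - h)) * φ x ∂μ := by
          rw [← integral_sub i1 i2]
          congr 1 with x
          ring
      _ = ∫ x, (p (x + h) - p x) * φ x ∂μ -
            ∫ x, (p (x + h) - p (x + h - h)) * φ (x + h) ∂μ := by
          rw [← integral_add_right_eq_self (fun x => (p x - p (x - h)) * φ x) h]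
      _ = ∫ x, (p (x + h) - p x) * (φ x - φ (x + h)) ∂μ := by
          rw [← integral_sub i1 i2']
          congr 1 with x
          rw [add_sub_cancel_right]
          ring
      _ ≤ ∫ x, {x | p x ≤ 4}.indicator (fun _ => a ^ 2) x ∂μ := by
          refine integral_mono ?_ ?_ ?_
          · refine (i1.sub i2').congr (Filter.Eventually.of_forall fun x => ?_)
            simp only [Pi.sub_apply, add_sub_cancel_right]
            ring
          · exact (integrable_indicator_iff (hmeas 4)).2 (integrableOn_const hfin)
          intro x
          by_cases hx : p x ≤ 4
          · simp only [indicator, mem_ofPred_eq, hx, if_true]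
            have e1 := hp.abs_sub_le (x := x) h₁ h₂
            have e2 : |φ x - φ (x + h)| ≤ a := by
              refine (abs_max_sub_max_le_max _ _ _ _).trans ?_
              rw [sub_self, abs_zero]
              refine max_le ha0 ?_
              rwa [sub_sub_sub_cancel_left]
            calc _ ≤ |(p (x + h) - p x) * (φ x - φ (x + h))| := le_abs_self _
              _ = |p (x + h) - p x| * |φ x - φ (x + h)| := abs_mul _ _
              _ ≤ a * a := by gcongr
              _ = a ^ 2 := by ring
          · have e1 := abs_le.1 (hp.abs_sub_le (x := x) h₁ h₂)
            simp only [indicator, mem_ofPred_eq, hx, if_false]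
            rw [hφ0 x (by linarith), hφ0 (x + h) (by linarith)]
            simp
      _ = a ^ 2 * μ.real {x | p x ≤ 4} := by
          rw [integral_indicator (hmeas 4)]
          simp [mul_comm]
  calc ∫⁻ x in {x | p x ≤ 2}, ENNReal.ofReal (p (x + h) + p (x - h) - 2 * p x) ∂μ
      ≤ ∫⁻ x in {x | p x ≤ 2}, ENNReal.ofReal ((p (x + h) + p (x - h) - 2 * p x) * φ x) ∂μ := by
        refine setLIntegral_mono' (hmeas 2) fun x hx => ENNReal.ofReal_le_ofReal ?_
        have hx' : p x ≤ 2 := hx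
        have : 1 ≤ φ x := le_max_of_le_right (by linarith)
        nlinarith [hp.secondDiff_nonneg x h]
    _ ≤ ∫⁻ x, ENNReal.ofReal ((p (x + h) + p (x - h) - 2 * p x) * φ x) ∂μ :=
        setLIntegral_le_lintegral _ _
    _ = ENNReal.ofReal (∫ x, (p (x + h) + p (x - h) - 2 * p x) * φ x ∂μ) := by
        rw [ofReal_integral_eq_lintegral_ofReal (hint _ (by fun_prop))]
        exact Filter.Eventually.of_forall fun x =>
          mul_nonneg (hp.secondDiff_nonneg x h) (le_max_left _ _)
    _ ≤ ENNReal.ofReal (a ^ 2 * μ.real {x | p x ≤ 4}) := ENNReal.ofReal_le_ofReal hle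
    _ = _ := by
        rw [ENNReal.ofReal_mul (by positivity), measureReal_def, ENNReal.ofReal_toReal hfin]

variable [FiniteDimensional ℝ E]

theorem measure_sublevel (hp : IsConvexGauge p) {r : ℝ} (hr : 0 < r) :
    μ {x | p x ≤ r} = ENNReal.ofReal (r ^ Module.finrank ℝ E) * μ {x | p x ≤ 1} := by
  rw [hp.sublevel_eq hr, image_smul, Measure.addHaar_smul, abs_of_nonneg (by positivity)]

/-- An integral over the unit sublevel set is at most its average over radial dilations. -/
theorem lintegral_sublevel_le (hp : IsConvexGauge p) {F : E → ℝ≥0∞} (hF : Measurable F) :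
    ∫⁻ x in {x | p x ≤ 1}, F x ∂μ ≤
      ∫⁻ x in {x | p x ≤ 2}, ∫⁻ t in Icc (1 : ℝ) 2, (Ici (p x)).indicator (fun t => F (t⁻¹ • x)) t
        ∂volume ∂μ := by
  have hpm : Measurable p := hp.continuous.measurable
  have hmeas : ∀ r : ℝ, MeasurableSet {x | p x ≤ r} := fun r => measurableSet_le hpm measurable_const
  have hset : ∀ t : ℝ, 0 < t → ∀ x, p (t⁻¹ • x) ≤ 1 ↔ p x ≤ t := by
    intro t ht x
    rw [hp.map_smul _ (by positivity), inv_mul_le_iff₀ ht, mul_one]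
  have hdil : ∀ t ∈ Icc (1 : ℝ) 2, ∫⁻ x in {x | p x ≤ 1}, F x ∂μ ≤
      ∫⁻ x in {x | p x ≤ 2}, (Ici (p x)).indicator (fun t => F (t⁻¹ • x)) t ∂μ := by
    intro t ht
    have ht0 : 0 < t := by linarith [ht.1]
    rw [← lintegral_indicator (hmeas 1), ← lintegral_indicator (hmeas 2)]
    have hmap := Measure.map_addHaar_smul μ (inv_ne_zero ht0.ne')
    set H := {x | p x ≤ 1}.indicator F with hH
    have hHm : Measurable H := hF.indicator (hmeas 1)
    have h1 : ∫⁻ x, H x ∂μ ≤ ∫⁻ x, H (t⁻¹ • x) ∂μ := by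
      rw [← lintegral_map hHm (measurable_const_smul _), hmap, lintegral_smul_measure]
      refine le_mul_of_one_le_left' ?_
      rw [← ENNReal.ofReal_one]
      refine ENNReal.ofReal_le_ofReal ?_
      rw [inv_pow, inv_inv, abs_of_nonneg (by positivity)]
      exact one_le_pow₀ ht.1
    refine h1.trans (lintegral_mono fun x => ?_)
    by_cases hx : p x ≤ t
    · have hx2 : p x ≤ 2 := hx.trans ht.2
      simp [hH, indicator, hset t ht0, hx, hx2]
    · simp [hH, indicator, hset t ht0, hx]
  calc ∫⁻ x in {x | p x ≤ 1}, F x ∂μ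
      = ∫⁻ t in Icc (1 : ℝ) 2, ∫⁻ x in {x | p x ≤ 1}, F x ∂μ ∂volume := by
        rw [setLIntegral_const, Real.volume_Icc]; norm_num
    _ ≤ ∫⁻ t in Icc (1 : ℝ) 2, ∫⁻ x in {x | p x ≤ 2},
          (Ici (p x)).indicator (fun t => F (t⁻¹ • x)) t ∂μ ∂volume :=
        setLIntegral_mono' measurableSet_Icc hdil
    _ = _ := by
        refine lintegral_lintegral_swap ?_
        have : (Function.uncurry fun (t : ℝ) (x : E) =>
            (Ici (p x)).indicator (fun t => F (t⁻¹ • x)) t) =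
            {z : ℝ × E | p z.2 ≤ z.1}.indicator fun z => F (z.1⁻¹ • z.2) := by
          ext ⟨t, x⟩
          simp [indicator]
        rw [this]
        exact ((hF.comp (measurable_fst.inv.smul measurable_snd)).indicator
          (measurableSet_le (hpm.comp measurable_snd) measurable_fst)).aemeasurable

end Measure

end IsConvexGauge

section Surround

variable {ι : Type*}

/-- The closed unit box in the orthant with sign pattern `ε`. -/
def orthantBox (ε : ι → Bool) : Set (ι → ℝ) :=
  Set.pi univ fun i => if ε i then Icc (0 : ℝ) 1 else Icc (-1 : ℝ) 0

theorem isCompact_orthantBox (ε : ι → Bool) : IsCompact (orthantBox ε) := by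
  refine isCompact_univ_pi fun i => ?_
  split_ifs <;> exact isCompact_Icc

theorem abs_le_one_of_mem_orthantBox {ε : ι → Bool} {a : ι → ℝ} (ha : a ∈ orthantBox ε) (i : ι) :
    |a i| ≤ 1 := by
  have := ha i (mem_univ i)
  rw [abs_le]
  dsimp only at this
  split_ifs at this <;> constructor <;> linarith [this.1, this.2]

variable [Fintype ι]

theorem volume_orthantBox (ε : ι → Bool) : volume (orthantBox ε) = 1 := by
  rw [orthantBox, volume_pi_pi]
  refine Finset.prod_eq_one fun i _ => ?_
  split_ifs <;> simp [Real.volume_Icc]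

variable [DecidableEq ι]

theorem IsConvexGauge.le_support_add_secondDiff {p : (ι → ℝ) → ℝ} (hp : IsConvexGauge p)
    {η : ℝ} (hη : 0 < η) {x h : ι → ℝ} {l : (ι → ℝ) →ₗ[ℝ] ℝ} (hlx : l x = p x)
    (hl : ∀ y, l y ≤ p y) (hh : ∑ i, |h i| ≤ η) :
    p (x + h) ≤ l (x + h) +
      ∑ i, (p (x + Pi.single i η) + p (x - Pi.single i η) - 2 * p x) := by
  set c : ι → ℝ := fun i => |h i| / η with hc
  set y : ι → (ι → ℝ) := fun i => x + Pi.single i (SignType.sign (h i) * η) with hy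
  have hp0 : p 0 = 0 := by simpa using hp.map_smul 0 le_rfl 0
  have hc0 : ∀ i, 0 ≤ c i := fun i => by positivity
  have hcs : ∑ i, c i ≤ 1 := by
    rw [← Finset.sum_div, div_le_one hη]
    exact hh
  have hc1 : ∀ i, c i ≤ 1 := fun i =>
    (Finset.single_le_sum (fun j _ => hc0 j) (Finset.mem_univ i)).trans hcs
  have hdec : x + h = (1 - ∑ i, c i) • x + ∑ i, c i • y i := by
    have : ∑ i, c i • y i = (∑ i, c i) • x + h := by
      simp only [hy, smul_add, Finset.sum_add_distrib, Finset.sum_smul]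
      congr 1
      ext j
      simp only [Finset.sum_apply, Pi.smul_apply, Pi.single_apply, smul_eq_mul, mul_ite, mul_zero,
        Finset.sum_ite_eq, Finset.mem_univ, if_true, hc]
      rw [← abs_mul_sign (h j)]
      field_simp
      simp [abs_mul_sign]
    rw [this]
    module
  have hq : ∀ i, p (y i) - l (y i) ≤
      p (x + Pi.single i η) + p (x - Pi.single i η) - 2 * p x := by
    intro i
    have e1 := hl (x + Pi.single i η)
    have e2 := hl (x - Pi.single i η)
    have e3 := hp.secondDiff_nonneg x (Pi.single i η)
    rw [map_add, hlx] at e1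
    rw [map_sub, hlx] at e2
    rcases lt_trichotomy (h i) 0 with hi | hi | hi
    · have : y i = x - Pi.single i η := by simp [hy, sign_neg hi, sub_eq_add_neg, Pi.single_neg]
      rw [this, map_sub, hlx]
      linarith
    · have : y i = x := by simp [hy, hi]
      rw [this, hlx]
      linarith
    · have : y i = x + Pi.single i η := by simp [hy, sign_pos hi]
      rw [this, map_add, hlx]
      linarith
  have h1 : p (x + h) ≤ (1 - ∑ i, c i) * p x + ∑ i, c i * p (y i) := by
    rw [hdec]
    refine (hp.add_le _ _).trans ?_
    rw [hp.map_smul _ (by linarith)]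
    gcongr
    refine (Finset.le_sum_of_subadditive p hp0.le hp.add_le _ _).trans_eq ?_
    exact Finset.sum_congr rfl fun i _ => hp.map_smul _ (hc0 i) _
  have h2 : l (x + h) = (1 - ∑ i, c i) * p x + ∑ i, c i * l (y i) := by
    rw [hdec, map_add, LinearMap.map_smul, hlx, map_sum]
    simp
  have h3 : ∑ i, c i * p (y i) - ∑ i, c i * l (y i) ≤
      ∑ i, (p (x + Pi.single i η) + p (x - Pi.single i η) - 2 * p x) := by
    rw [← Finset.sum_sub_distrib]
    refine Finset.sum_le_sum fun i _ => ?_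
    rw [← mul_sub]
    have := hl (y i)
    exact (mul_le_of_le_one_left (by linarith) (hc1 i)).trans (hq i)
  linarith

theorem exists_orthantBox_nonneg (g : (ι → ℝ) →ₗ[ℝ] ℝ) :
    ∃ ε : ι → Bool, ∀ a ∈ orthantBox ε, 0 ≤ g a := by
  refine ⟨fun i => decide (0 ≤ g (Pi.single i 1)), fun a ha => ?_⟩
  rw [LinearMap.pi_apply_eq_sum_univ g a]
  refine Finset.sum_nonneg fun i _ => ?_
  have := ha i (mem_univ i)
  have e : (fun j => if i = j then (1 : ℝ) else 0) = Pi.single i 1 := by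
    ext j; simp [Pi.single_apply, eq_comm]
  rw [e, smul_eq_mul]
  by_cases h : 0 ≤ g (Pi.single i 1)
  · simp only [h, decide_true, if_true] at this
    exact mul_nonneg this.1 h
  · simp only [h, decide_false] at this
    exact mul_nonneg_of_nonpos_of_nonpos this.2 (not_le.1 h).le

/-- If the second differences of a gauge `p` at `x` are small compared with the depth `s` of `x`,
then the body `{p ≤ 1}` contains boxes of controlled volume that surround `x`. -/
theorem IsConvexGauge.exists_surrounding_boxes [Nonempty ι] {p : (ι → ℝ) → ℝ}
    (hp : IsConvexGauge p) {L : ℝ} (hL0 : 0 < L) (hL₁ : ∀ i, p (Pi.single i 1) ≤ L)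
    (hL₂ : ∀ i, p (-Pi.single i 1) ≤ L) {η : ℝ} (hη : 0 < η) {x : ι → ℝ} {s : ℝ} (hs : 0 ≤ s)
    (hxs : p x ≤ 1 - s)
    (hD : ∑ i, (p (x + Pi.single i η) + p (x - Pi.single i η) - 2 * p x) ≤ s / 4) :
    ∃ S : (ι → Bool) → Set (ι → ℝ), (∀ ε, MeasurableSet (S ε)) ∧ (∀ ε, S ε ⊆ {z | p z ≤ 1}) ∧
      (∀ ε, volume (S ε) = ENNReal.ofReal ((η / (2 * Fintype.card ι)) ^ (Fintype.card ι - 1) *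
        min (s / (2 * L)) (η / (2 * Fintype.card ι)))) ∧
      ∀ f : (ι → ℝ) →ₗ[ℝ] ℝ, ∃ ε, ∀ z ∈ S ε, f x ≤ f z := by
  have hd : (0 : ℝ) < Fintype.card ι := by exact_mod_cast Fintype.card_pos
  obtain ⟨l, hlx, hl⟩ := hp.exists_support x
  set r : ℝ := η / (2 * Fintype.card ι) with hr
  set σ : ℝ := min (s / (2 * L)) r with hσ
  have hr0 : 0 < r := by positivity
  have hσ0 : 0 ≤ σ := le_min (by positivity) hr0.le
  have hσr : σ ≤ r := min_le_right _ _
  have hσs : σ * L ≤ s / 2 := by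
    calc σ * L ≤ s / (2 * L) * L := by gcongr; exact min_le_left _ _
      _ = s / 2 := by field_simp
  set m : ι → ℝ := fun i => l (Pi.single i 1) with hm
  have hmL : ∀ i, |m i| ≤ L := by
    intro i
    rw [abs_le]
    have := (hl (-Pi.single i 1)).trans (hL₂ i)
    rw [map_neg] at this
    exact ⟨by simp only [hm]; linarith, (hl _).trans (hL₁ i)⟩
  obtain ⟨k, hk⟩ := Finite.exists_max fun i => |m i|
  set v : ι → ℝ := fun j => if j = k then σ else -(r * (m j / m k)) with hv
  set W : Matrix ι ι ℝ := (r • (1 : Matrix ι ι ℝ)).updateRow k v with hW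
  have hdet : W.det = r ^ (Fintype.card ι - 1) * σ := by
    rw [hW, ← Matrix.cramer_transpose_apply, Matrix.transpose_smul, Matrix.transpose_one,
      Matrix.cramer_smul, Matrix.cramer_one]
    simp [hv]
  have hWk : ∀ a, (W.mulVec a) k = ∑ j, v j * a j := by
    intro a
    simp [hW, Matrix.mulVec, dotProduct]
  have hWi : ∀ a i, i ≠ k → (W.mulVec a) i = r * a i := by
    intro a i hi
    simp [hW, Matrix.mulVec, dotProduct, Matrix.updateRow_ne hi, Matrix.one_apply]
  have hratio : ∀ j, |m j / m k| ≤ 1 := by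
    intro j
    rw [abs_div]
    exact div_le_one_of_le₀ (hk j) (abs_nonneg _)
  have hcancel : ∀ j, m k * (m j / m k) = m j := by
    intro j
    by_cases h0 : m k = 0
    · have := hk j
      rw [h0, abs_zero] at this
      simp [h0, abs_nonpos_iff.1 this]
    · field_simp
  have hlW : ∀ a, l (W.mulVec a) = σ * m k * a k := by
    intro a
    have e : ∀ i : ι, (fun j => if i = j then (1 : ℝ) else 0) = Pi.single i 1 := by
      intro i; ext j; simp [Pi.single_apply, eq_comm]
    rw [LinearMap.pi_apply_eq_sum_univ l]
    simp only [e, smul_eq_mul]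
    rw [← Finset.add_sum_erase _ _ (Finset.mem_univ k), hWk,
      ← Finset.add_sum_erase _ _ (Finset.mem_univ k), add_mul, Finset.sum_mul, add_assoc,
      ← Finset.sum_add_distrib, Finset.sum_eq_zero]
    · simp [hv, hm]; ring
    · intro j hj
      have hj' := Finset.ne_of_mem_erase hj
      rw [hWi _ _ hj']
      change v j * a j * m k + r * a j * m j = 0
      simp only [hv, hj', if_false]
      linear_combination (-(r * a j)) * hcancel j
  have hsum : ∀ a : ι → ℝ, (∀ i, |a i| ≤ 1) → ∑ i, |W.mulVec a i| ≤ η := by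
    intro a ha
    have hvj : ∀ j, |v j| ≤ r := by
      intro j
      simp only [hv]
      split_ifs
      · rwa [abs_of_nonneg hσ0]
      · rw [abs_neg, abs_mul, abs_of_pos hr0]
        exact mul_le_of_le_one_right hr0.le (hratio j)
    have h1 : |W.mulVec a k| ≤ Fintype.card ι * r := by
      rw [hWk]
      refine (Finset.abs_sum_le_sum_abs _ _).trans ?_
      calc ∑ j, |v j * a j| ≤ ∑ j : ι, r := by
            refine Finset.sum_le_sum fun j _ => ?_
            rw [abs_mul]
            calc |v j| * |a j| ≤ r * 1 := by gcongr; exacts [hvj j, ha j]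
              _ = r := mul_one r
        _ = _ := by simp
    have h2 : ∑ i ∈ Finset.univ.erase k, |W.mulVec a i| ≤ Fintype.card ι * r := by
      calc ∑ i ∈ Finset.univ.erase k, |W.mulVec a i| ≤ ∑ i ∈ Finset.univ.erase k, r := by
            refine Finset.sum_le_sum fun j hj => ?_
            rw [hWi _ _ (Finset.ne_of_mem_erase hj), abs_mul, abs_of_pos hr0]
            exact mul_le_of_le_one_right hr0.le (ha j)
        _ ≤ ∑ i : ι, r := Finset.sum_le_sum_of_subset_of_nonneg (Finset.subset_univ _)
            fun _ _ _ => hr0.le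
        _ = _ := by simp
    rw [← Finset.add_sum_erase _ _ (Finset.mem_univ k)]
    calc _ ≤ Fintype.card ι * r + Fintype.card ι * r := add_le_add h1 h2
      _ = η := by rw [hr]; field_simp; ring
  refine ⟨fun ε => (fun h => x + h) '' (Matrix.toLin' W '' orthantBox ε), ?_, ?_, ?_, ?_⟩
  · intro ε
    exact (((isCompact_orthantBox ε).image
      (LinearMap.continuous_of_finiteDimensional _)).image (by fun_prop)).measurableSet
  · rintro ε _ ⟨_, ⟨a, ha, rfl⟩, rfl⟩
    have ha1 := abs_le_one_of_mem_orthantBox ha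
    simp only [Matrix.toLin'_apply, mem_ofPred_eq]
    have h1 := hp.le_support_add_secondDiff hη hlx hl (hsum a ha1)
    rw [map_add, hlx, hlW] at h1
    have h2 : σ * m k * a k ≤ s / 2 := by
      calc σ * m k * a k ≤ |σ * m k * a k| := le_abs_self _
        _ = σ * |m k| * |a k| := by rw [abs_mul, abs_mul, abs_of_nonneg hσ0]
        _ ≤ σ * L * 1 := by gcongr; exacts [hmL k, ha1 k]
        _ ≤ s / 2 := by linarith
    linarith
  · intro ε
    change volume ((fun h => x + h) '' (Matrix.toLin' W '' orthantBox ε)) = _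
    rw [image_add_left, measure_preimage_add, Measure.addHaar_image_linearMap, volume_orthantBox,
      LinearMap.det_toLin', hdet, abs_of_nonneg (by positivity), mul_one]
  · intro f
    obtain ⟨ε, hε⟩ := exists_orthantBox_nonneg (f ∘ₗ Matrix.toLin' W)
    refine ⟨ε, ?_⟩
    rintro _ ⟨_, ⟨a, ha, rfl⟩, rfl⟩
    have := hε a ha
    simp only [LinearMap.comp_apply] at this
    simp only [map_add]
    linarith

end Surround

section Radial

variable {E : Type*} [NormedAddCommGroup E] [NormedSpace ℝ E] [FiniteDimensional ℝ E]
  [MeasurableSpace E] [BorelSpace E] (μ : Measure E) [μ.IsAddHaarMeasure] {p : E → ℝ}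

theorem IsConvexGauge.lintegral_exp_neg_depth_le (hp : IsConvexGauge p) {κ : ℝ} (hκ : 0 < κ) :
    ∫⁻ x in {x | p x ≤ 1}, ENNReal.ofReal (Real.exp (-(κ * (1 - p x)))) ∂μ ≤
      ENNReal.ofReal (2 / κ) * μ {x | p x ≤ 2} := by
  have hpm : Measurable p := hp.continuous.measurable
  refine (hp.lintegral_sublevel_le μ (by fun_prop)).trans ?_
  rw [← setLIntegral_const]
  refine lintegral_mono fun x => ?_
  have hκ2 : -(κ / 2) < 0 := by linarith
  calc ∫⁻ t in Icc (1 : ℝ) 2, (Ici (p x)).indicator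
        (fun t => ENNReal.ofReal (Real.exp (-(κ * (1 - p (t⁻¹ • x)))))) t
      ≤ ∫⁻ t in Icc (1 : ℝ) 2, (Ici (p x)).indicator
        (fun t => ENNReal.ofReal (Real.exp (κ / 2 * p x) * Real.exp (-(κ / 2) * t))) t := by
        refine setLIntegral_mono' measurableSet_Icc fun t ht => ?_
        have ht0 : 0 < t := by linarith [ht.1]
        by_cases hpt : p x ≤ t
        swap
        · simp [indicator, hpt]
        simp only [indicator, mem_Ici, hpt, if_true]
        rw [← Real.exp_add, hp.map_smul _ (by positivity)]
        refine ENNReal.ofReal_le_ofReal (Real.exp_le_exp.2 ?_)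
        have e1 : (t - p x) / 2 ≤ (t - p x) / t :=
          div_le_div_of_nonneg_left (by linarith) ht0 ht.2
        have e2 : (t - p x) / t = 1 - t⁻¹ * p x := by field_simp
        rw [e2] at e1
        nlinarith
    _ ≤ ∫⁻ t, (Ici (p x)).indicator
        (fun t => ENNReal.ofReal (Real.exp (κ / 2 * p x) * Real.exp (-(κ / 2) * t))) t :=
        setLIntegral_le_lintegral _ _
    _ = ∫⁻ t in Ioi (p x), ENNReal.ofReal (Real.exp (κ / 2 * p x) * Real.exp (-(κ / 2) * t)) := by
        rw [lintegral_indicator measurableSet_Ici, setLIntegral_congr Ioi_ae_eq_Ici]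
    _ = ENNReal.ofReal (∫ t in Ioi (p x), Real.exp (κ / 2 * p x) * Real.exp (-(κ / 2) * t)) := by
        rw [ofReal_integral_eq_lintegral_ofReal]
        · exact (integrableOn_exp_mul_Ioi hκ2 _).const_mul _
        · exact Filter.Eventually.of_forall fun t => by positivity
    _ = ENNReal.ofReal (2 / κ) := by
        rw [integral_const_mul, integral_exp_mul_Ioi hκ2]
        congr 1
        rw [neg_div_neg_eq, mul_div_assoc', ← Real.exp_add]
        simp

theorem IsConvexGauge.measure_depth_lt_secondDiff_le (hp : IsConvexGauge p) {ι : Type*} [Fintype ι]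
    (h : ι → E) :
    μ {x | p x ≤ 1 ∧ (1 - p x) / 4 < ∑ i, (p (x + h i) + p (x - h i) - 2 * p x)} ≤
      4 * ∑ i, ∫⁻ x in {x | p x ≤ 2},
        ENNReal.ofReal (p (x + (2 : ℝ) • h i) + p (x - (2 : ℝ) • h i) - 2 * p x) ∂μ := by
  have hpm : Measurable p := hp.continuous.measurable
  have hpc := hp.continuous
  set B : Set E := {x | (1 - p x) / 4 < ∑ i, (p (x + h i) + p (x - h i) - 2 * p x)} with hB
  have hBm : MeasurableSet B := by
    refine measurableSet_lt (by fun_prop) (Continuous.measurable (by fun_prop))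
  have h1 : μ {x | p x ≤ 1 ∧ (1 - p x) / 4 < ∑ i, (p (x + h i) + p (x - h i) - 2 * p x)} =
      ∫⁻ x in {x | p x ≤ 1}, B.indicator 1 x ∂μ := by
    rw [lintegral_indicator_one hBm, Measure.restrict_apply hBm, inter_comm]
    rfl
  rw [h1]
  refine (hp.lintegral_sublevel_le μ (measurable_one.indicator hBm)).trans ?_
  rw [← lintegral_finsetSum _ (fun i _ => by fun_prop), ← lintegral_const_mul _ (by fun_prop)]
  refine lintegral_mono fun x => ?_
  set D : ℝ := ∑ i, (p (x + (2 : ℝ) • h i) + p (x - (2 : ℝ) • h i) - 2 * p x) with hD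
  calc ∫⁻ t in Icc (1 : ℝ) 2, (Ici (p x)).indicator (fun t => B.indicator 1 (t⁻¹ • x)) t
      ≤ ∫⁻ t in Icc (1 : ℝ) 2, (Icc (p x) (p x + 4 * D)).indicator 1 t := by
        refine setLIntegral_mono' measurableSet_Icc fun t ht => ?_
        have ht0 : 0 < t := by linarith [ht.1]
        by_cases hpt : p x ≤ t
        swap
        · simp [indicator, hpt]
        by_cases htB : t⁻¹ • x ∈ B
        swap
        · simp [indicator, htB]
        have : t ∈ Icc (p x) (p x + 4 * D) := by
          refine ⟨hpt, ?_⟩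
          rw [hB, mem_ofPred_eq] at htB
          have e1 : ∀ i, p (t⁻¹ • x + h i) + p (t⁻¹ • x - h i) - 2 * p (t⁻¹ • x) ≤
              t⁻¹ * (p (x + (2 : ℝ) • h i) + p (x - (2 : ℝ) • h i) - 2 * p x) := by
            intro i
            have := hp.secondDiff_mono x ((2 : ℝ) • h i) (t := t / 2) (by linarith)
              (by linarith [ht.2])
            rw [smul_smul, div_mul_cancel₀ _ (two_ne_zero)] at this
            have e2 : t⁻¹ • x + h i = t⁻¹ • (x + t • h i) := by
              rw [smul_add, inv_smul_smul₀ ht0.ne']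
            have e3 : t⁻¹ • x - h i = t⁻¹ • (x - t • h i) := by
              rw [smul_sub, inv_smul_smul₀ ht0.ne']
            rw [e2, e3, hp.map_smul _ (by positivity), hp.map_smul _ (by positivity),
              hp.map_smul _ (by positivity)]
            calc _ = t⁻¹ * (p (x + t • h i) + p (x - t • h i) - 2 * p x) := by ring
              _ ≤ _ := by gcongr
          have e4 := htB.trans_le (Finset.sum_le_sum fun i _ => e1 i)
          rw [← Finset.mul_sum, hp.map_smul _ (by positivity), ← hD] at e4
          have e5 := mul_lt_mul_of_pos_left e4 ht0
          have e6 : t * ((1 - t⁻¹ * p x) / 4) = (t - p x) / 4 := by field_simp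
          rw [e6, mul_inv_cancel_left₀ ht0.ne'] at e5
          linarith
        simp only [indicator, this, if_true, Pi.one_apply]
        split_ifs <;> simp
    _ ≤ ∫⁻ t, (Icc (p x) (p x + 4 * D)).indicator 1 t := setLIntegral_le_lintegral _ _
    _ = ENNReal.ofReal (4 * D) := by
        rw [lintegral_indicator_one measurableSet_Icc, Real.volume_Icc, add_sub_cancel_left]
    _ = 4 * ∑ i, ENNReal.ofReal
          (p (x + (2 : ℝ) • h i) + p (x - (2 : ℝ) • h i) - 2 * p x) := by
        rw [ENNReal.ofReal_mul (by norm_num), hD,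
          ENNReal.ofReal_sum_of_nonneg fun i _ => hp.secondDiff_nonneg x _]
        norm_num

end Radial

section Sampling

variable {E : Type*} [NormedAddCommGroup E] [NormedSpace ℝ E]

theorem isClosed_mem_convexHull_range (n : ℕ) :
    IsClosed {z : E × (Fin n → E) | z.1 ∈ convexHull ℝ (range z.2)} := by
  have h1 : {z : E × (Fin n → E) | z.1 ∈ convexHull ℝ (range z.2)} =
      Prod.snd '' {q : stdSimplex ℝ (Fin n) × (E × (Fin n → E)) |
        ∑ i, q.1.1 i • q.2.2 i = q.2.1} := by
    ext ⟨x, ω⟩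
    have h2 : convexHull ℝ (range ω) =
        (fun w : Fin n → ℝ => ∑ i, w i • ω i) '' stdSimplex ℝ (Fin n) := by
      rw [← convexHull_rangle_single_eq_stdSimplex]
      have := (Fintype.linearCombination ℝ ω).image_convexHull
        (range fun i : Fin n => Pi.single i (1 : ℝ))
      rw [← range_comp] at this
      convert this.symm using 2
      · congr 1 with i
        simp
      · exact (Fintype.linearCombination_apply ℝ ω _).symm
    simp only [mem_ofPred_eq, h2, mem_image, Prod.exists, Subtype.exists]
    constructor
    · rintro ⟨w, hw, h⟩
      exact ⟨w, hw, x, ω, h, rfl⟩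
    · rintro ⟨w, hw, y, υ, h, e⟩
      cases e
      exact ⟨w, hw, h⟩
  rw [h1]
  exact isClosedMap_snd_of_compactSpace _ (isClosed_eq
    (continuous_finsetSum _ fun i _ => ((continuous_apply i).comp
      (continuous_subtype_val.comp continuous_fst)).smul (by fun_prop)) (by fun_prop))

variable [FiniteDimensional ℝ E] [MeasurableSpace E]

/-- If every closed half-space through `x` contains one of finitely many sets of mass at least `v`,
then `x` is unlikely to lie outside the convex hull of a sample. -/
theorem measure_notMem_convexHull_le {n : ℕ} (P : Measure E) [IsProbabilityMeasure P] {κ : Type*}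
    [Fintype κ] {S : κ → Set E} (hS : ∀ ε, MeasurableSet (S ε)) {v : ℝ}
    (hv : ∀ ε, ENNReal.ofReal v ≤ P (S ε)) {x : E}
    (hx : ∀ f : E →ₗ[ℝ] ℝ, ∃ ε, ∀ z ∈ S ε, f x ≤ f z) :
    Measure.pi (fun _ : Fin n => P) {ω | x ∉ convexHull ℝ (range ω)} ≤
      Fintype.card κ * ENNReal.ofReal (Real.exp (-(n * v))) := by
  have hsub : {ω : Fin n → E | x ∉ convexHull ℝ (range ω)} ⊆
      ⋃ ε, Set.pi univ fun _ : Fin n => (S ε)ᶜ := by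
    intro ω hω
    obtain ⟨f, u, h1, h2⟩ := geometric_hahn_banach_closed_point (convex_convexHull ℝ (range ω))
      ((finite_range ω).isClosed_convexHull ℝ) hω
    obtain ⟨ε, hε⟩ := hx f
    refine mem_iUnion.2 ⟨ε, fun i _ hi => ?_⟩
    have h3 := h1 _ (subset_convexHull ℝ _ (mem_range_self i))
    have h4 : f x ≤ f (ω i) := hε _ hi
    linarith
  have hone : ∀ ε, P (S ε)ᶜ ≤ ENNReal.ofReal (Real.exp (-v)) := by
    intro ε
    rw [prob_compl_eq_one_sub (hS ε)]
    calc 1 - P (S ε) ≤ 1 - ENNReal.ofReal v := tsub_le_tsub_left (hv ε) _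
      _ ≤ ENNReal.ofReal (1 - v) := by
        rw [tsub_le_iff_right, ← ENNReal.ofReal_one]
        exact (ENNReal.ofReal_le_ofReal (by linarith)).trans ENNReal.ofReal_add_le
      _ ≤ _ := ENNReal.ofReal_le_ofReal (by linarith [Real.add_one_le_exp (-v)])
  calc _ ≤ Measure.pi (fun _ : Fin n => P) (⋃ ε, Set.pi univ fun _ : Fin n => (S ε)ᶜ) :=
        measure_mono hsub
    _ ≤ ∑ ε, Measure.pi (fun _ : Fin n => P) (Set.pi univ fun _ : Fin n => (S ε)ᶜ) :=
        measure_iUnion_fintype_le _ _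
    _ ≤ ∑ _ε : κ, ENNReal.ofReal (Real.exp (-(n * v))) := by
        refine Finset.sum_le_sum fun ε _ => ?_
        rw [Measure.pi_pi, Finset.prod_const, Finset.card_univ, Fintype.card_fin]
        calc _ ≤ ENNReal.ofReal (Real.exp (-v)) ^ n := by gcongr; exact hone ε
          _ = _ := by
            rw [← ENNReal.ofReal_pow (Real.exp_pos _).le, ← Real.exp_nat_mul]
            congr 2
            ring
    _ = _ := by simp

variable [BorelSpace E]

theorem lintegral_measure_diff_convexHull (μ : Measure E) [SFinite μ] {n : ℕ}
    (ν : Measure (Fin n → E)) [SFinite ν] (G : Set E) :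
    ∫⁻ ω, μ (G \ convexHull ℝ (range ω)) ∂ν =
      ∫⁻ x in G, ν {ω | x ∉ convexHull ℝ (range ω)} ∂μ := by
  have hN : MeasurableSet {z : E × (Fin n → E) | z.1 ∉ convexHull ℝ (range z.2)} :=
    (isClosed_mem_convexHull_range n).measurableSet.compl
  have h1 : ∀ ω : Fin n → E, MeasurableSet {x | x ∉ convexHull ℝ (range ω)} := fun ω =>
    measurable_prodMk_right hN
  have h2 : ∀ x : E, MeasurableSet {ω : Fin n → E | x ∉ convexHull ℝ (range ω)} := fun x =>
    measurable_prodMk_left hN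
  calc ∫⁻ ω, μ (G \ convexHull ℝ (range ω)) ∂ν
      = ∫⁻ ω, ∫⁻ x in G, {z : E × (Fin n → E) | z.1 ∉ convexHull ℝ (range z.2)}.indicator 1 (x, ω)
          ∂μ ∂ν := by
        refine lintegral_congr fun ω => ?_
        have : (fun x => {z : E × (Fin n → E) | z.1 ∉ convexHull ℝ (range z.2)}.indicator
            (1 : E × (Fin n → E) → ℝ≥0∞) (x, ω)) =
            {x | x ∉ convexHull ℝ (range ω)}.indicator 1 := rfl
        rw [this, lintegral_indicator_one (h1 ω), Measure.restrict_apply (h1 ω), inter_comm]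
        rfl
    _ = ∫⁻ x in G, ∫⁻ ω, {z : E × (Fin n → E) | z.1 ∉ convexHull ℝ (range z.2)}.indicator 1 (x, ω)
          ∂ν ∂μ := by
        refine lintegral_lintegral_swap ?_
        exact ((measurable_one.indicator hN).comp measurable_swap).aemeasurable
    _ = _ := by
        refine lintegral_congr fun x => ?_
        have : (fun ω => {z : E × (Fin n → E) | z.1 ∉ convexHull ℝ (range z.2)}.indicator
            (1 : E × (Fin n → E) → ℝ≥0∞) (x, ω)) =
            {ω : Fin n → E | x ∉ convexHull ℝ (range ω)}.indicator 1 := rfl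
        rw [this, lintegral_indicator_one (h2 x)]

end Sampling

section Bound

variable {ι : Type*} [Fintype ι] [DecidableEq ι]

theorem exp_neg_mul_min_le {c τ : ℝ} (hc : 0 < c) (hτ : 0 < τ) (s : ℝ) :
    Real.exp (-(c / τ ^ 2 * min s τ)) ≤
      Real.exp (-(c / τ ^ 2 * s)) + 2 / c ^ 2 * τ ^ 2 := by
  rcases le_total s τ with h | h
  · rw [min_eq_left h]
    have : 0 ≤ 2 / c ^ 2 * τ ^ 2 := by positivity
    linarith
  · rw [min_eq_right h]
    have e : c / τ ^ 2 * τ = c / τ := by field_simp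
    have h1 := Real.quadratic_le_exp_of_nonneg (x := c / τ) (by positivity)
    have h2 : Real.exp (-(c / τ)) ≤ 2 / c ^ 2 * τ ^ 2 := by
      rw [Real.exp_neg]
      calc (Real.exp (c / τ))⁻¹ ≤ ((c / τ) ^ 2 / 2)⁻¹ := by
            apply inv_anti₀ (by positivity)
            have : 0 ≤ c / τ := by positivity
            linarith
        _ = _ := by field_simp
    rw [e]
    linarith [Real.exp_pos (-(c / τ ^ 2 * s))]

theorem IsConvexGauge.lintegral_failure_le (μ : Measure (ι → ℝ)) [μ.IsAddHaarMeasure]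
    {p : (ι → ℝ) → ℝ} (hp : IsConvexGauge p) {L : ℝ} (hL0 : 0 < L)
    (hL₁ : ∀ i, p (Pi.single i 1) ≤ L) (hL₂ : ∀ i, p (-Pi.single i 1) ≤ L)
    {τ : ℝ} (hτ : 0 < τ) (hτ1 : τ ≤ 1) {c : ℝ} (hc : 0 < c) {A : ℝ} (hA : 0 ≤ A) :
    ∫⁻ y in {y | p y ≤ 1}, (ENNReal.ofReal (A * Real.exp (-(c / τ ^ 2 * min (1 - p y) τ))) +
      {y | p y ≤ 1 ∧ (1 - p y) / 4 < ∑ i, (p (y + Pi.single i (τ / (2 * L))) +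
        p (y - Pi.single i (τ / (2 * L))) - 2 * p y)}.indicator 1 y) ∂μ ≤
      ENNReal.ofReal ((A * (2 / c * 2 ^ Fintype.card ι + 2 / c ^ 2) +
        4 * (Fintype.card ι * 4 ^ Fintype.card ι)) * τ ^ 2) * μ {y | p y ≤ 1} := by
  have hpc := hp.continuous
  have hpm : Measurable p := hpc.measurable
  have hK : MeasurableSet {y | p y ≤ 1} := measurableSet_le hpm measurable_const
  set m := μ {y | p y ≤ 1}
  have hfr : Module.finrank ℝ (ι → ℝ) = Fintype.card ι := Module.finrank_fintype_fun_eq_card ℝ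
  rw [lintegral_add_left (by fun_prop)]
  have h1 : ∫⁻ y in {y | p y ≤ 1}, ENNReal.ofReal (A * Real.exp (-(c / τ ^ 2 * min (1 - p y) τ))) ∂μ
      ≤ ENNReal.ofReal (A * (2 / c * 2 ^ Fintype.card ι + 2 / c ^ 2) * τ ^ 2) * m := by
    calc _ ≤ ∫⁻ y in {y | p y ≤ 1}, (ENNReal.ofReal A *
            ENNReal.ofReal (Real.exp (-(c / τ ^ 2 * (1 - p y)))) +
            ENNReal.ofReal (A * (2 / c ^ 2 * τ ^ 2))) ∂μ := by
          refine lintegral_mono fun y => ?_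
          rw [← ENNReal.ofReal_mul hA, ← ENNReal.ofReal_add (by positivity) (by positivity),
            ← mul_add]
          exact ENNReal.ofReal_le_ofReal
            (mul_le_mul_of_nonneg_left (exp_neg_mul_min_le hc hτ _) hA)
      _ ≤ ENNReal.ofReal A * (ENNReal.ofReal (2 / (c / τ ^ 2)) *
            (ENNReal.ofReal (2 ^ Fintype.card ι) * m)) +
            ENNReal.ofReal (A * (2 / c ^ 2 * τ ^ 2)) * m := by
          rw [lintegral_add_right _ measurable_const, setLIntegral_const,
            lintegral_const_mul _ (by fun_prop)]
          gcongr
          refine (hp.lintegral_exp_neg_depth_le μ (by positivity)).trans_eq ?_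
          rw [hp.measure_sublevel μ two_pos, hfr]
      _ = _ := by
          rw [← mul_assoc, ← mul_assoc, ← ENNReal.ofReal_mul hA,
            ← ENNReal.ofReal_mul (by positivity), ← add_mul,
            ← ENNReal.ofReal_add (by positivity) (by positivity)]
          congr 2
          field_simp
  have h2 : ∫⁻ y in {y | p y ≤ 1}, {y | p y ≤ 1 ∧ (1 - p y) / 4 <
      ∑ i, (p (y + Pi.single i (τ / (2 * L))) + p (y - Pi.single i (τ / (2 * L))) - 2 * p y)}.indicator
      1 y ∂μ ≤ ENNReal.ofReal (4 * (Fintype.card ι * 4 ^ Fintype.card ι) * τ ^ 2) * m := by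
    calc _ ≤ μ {y | p y ≤ 1 ∧ (1 - p y) / 4 < ∑ i, (p (y + Pi.single i (τ / (2 * L))) +
            p (y - Pi.single i (τ / (2 * L))) - 2 * p y)} := by
          refine (setLIntegral_le_lintegral _ _).trans ?_
          exact lintegral_indicator_one_le _
      _ ≤ 4 * ∑ i : ι, ENNReal.ofReal (τ ^ 2) * μ {x | p x ≤ 4} := by
          refine (hp.measure_depth_lt_secondDiff_le μ _).trans ?_
          gcongr with i
          have e : (2 : ℝ) • (Pi.single i (τ / (2 * L)) : ι → ℝ) = (τ / L) • Pi.single i 1 := by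
            rw [← Pi.single_smul', ← Pi.single_smul']
            congr 1
            simp only [smul_eq_mul]
            field_simp
          rw [e]
          refine hp.lintegral_secondDiff_le μ ?_ ?_ hτ1
          · rw [hp.map_smul _ (by positivity)]
            calc τ / L * p (Pi.single i 1) ≤ τ / L * L := by gcongr; exact hL₁ i
              _ = τ := by field_simp
          · rw [← smul_neg, hp.map_smul _ (by positivity)]
            calc τ / L * p (-Pi.single i 1) ≤ τ / L * L := by gcongr; exact hL₂ i
              _ = τ := by field_simp
      _ = _ := by
          rw [hp.measure_sublevel μ (by norm_num : (0 : ℝ) < 4), hfr, Finset.sum_const,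
            Finset.card_univ, nsmul_eq_mul, ENNReal.ofReal_mul (by positivity),
            ENNReal.ofReal_mul (by norm_num), ENNReal.ofReal_mul (by positivity),
            ENNReal.ofReal_natCast, ENNReal.ofReal_ofNat]
          ring
  refine (add_le_add h1 h2).trans_eq ?_
  rw [← add_mul, ← ENNReal.ofReal_add (by positivity) (by positivity)]
  congr 2
  ring

end Bound

section Position

/-- A convex body contains the vertices of a simplex in whose affine coordinates the body is
bounded and contains a neighbourhood of the centre, both uniformly in the body. -/
theorem IsConvexBody.exists_position {d : ℕ} {G : Set (Euc d)} (hG : IsConvexBody G) :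
    ∃ (e : Euc d ≃L[ℝ] (Fin d → ℝ)) (c : Euc d), (∀ x ∈ G, ∀ i, |e (x - c) i| ≤ 2) ∧
      ∀ y : Fin d → ℝ, ∑ i, |y i| ≤ 1 / (d + 1) → c + e.symm y ∈ G := by
  obtain ⟨hcpt, hconv, v₀, hv₀⟩ := hG
  set B : Module.Basis (Fin d) ℝ (Euc d) := (EuclideanSpace.basisFun (Fin d) ℝ).toBasis
  set f : (Fin d → Euc d) → ℝ := fun v => |B.det fun i => v i - v₀| with hf
  have hfc : Continuous f := by
    have : Continuous fun v : Fin d → Euc d => B.det v := by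
      simp only [Module.Basis.det_apply]
      refine Continuous.matrix_det ?_
      refine continuous_matrix fun i j => ?_
      simp only [Module.Basis.toMatrix_apply]
      exact (LinearMap.continuous_of_finiteDimensional (B.coord i)).comp (continuous_apply j)
    exact (this.comp (by fun_prop)).abs
  have hGpi : IsCompact (Set.pi univ fun _ : Fin d => G) := isCompact_univ_pi fun _ => hcpt
  have hv₀G := interior_subset hv₀
  obtain ⟨v, hv, hmax⟩ := hGpi.exists_isMaxOn ⟨fun _ => v₀, fun _ _ => hv₀G⟩ hfc.continuousOn
  have hpos : 0 < f v := by
    obtain ⟨r, hr, hball⟩ := Metric.isOpen_iff.1 isOpen_interior v₀ hv₀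
    have hmem : (fun i => v₀ + (r / 2) • B i) ∈ Set.pi univ fun _ : Fin d => G := by
      intro i _
      refine interior_subset (hball ?_)
      simp [B, norm_smul, abs_of_pos hr, hr]
    refine lt_of_lt_of_le ?_ (hmax hmem)
    simp only [hf, add_sub_cancel_left]
    have : (fun i => (r / 2) • B i) = fun i => (fun _ : Fin d => r / 2) i • B i := rfl
    rw [this, B.det.map_smul_univ, B.det_self]
    simp [hr.ne']
  have hdet : B.det (fun i => v i - v₀) ≠ 0 := abs_pos.1 hpos
  obtain ⟨hli, hsp⟩ := (B.is_basis_iff_det).2 (isUnit_iff_ne_zero.2 hdet)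
  set b : Module.Basis (Fin d) ℝ (Euc d) := Module.Basis.mk hli hsp.ge with hb
  have hbv : ∀ i, b i = v i - v₀ := fun i => by simp [hb]
  have hcoord : ∀ x ∈ G, ∀ i, |b.repr (x - v₀) i| ≤ 1 := by
    intro x hx i
    have h1 : B.det (Function.update b i (x - v₀)) = B.det b * b.repr (x - v₀) i := by
      rw [B.det.eq_smul_basis_det b]
      simp only [AlternatingMap.smul_apply, smul_eq_mul, b.det_self, mul_one]
      congr 1
      rw [Module.Basis.det_apply, Module.Basis.toMatrix_update, Module.Basis.toMatrix_self,
        ← Matrix.cramer_apply, Matrix.cramer_one]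
      rfl
    have h2 : f (Function.update v i x) ≤ f v := by
      refine hmax fun j _ => ?_
      by_cases hj : j = i
      · subst hj; simpa using hx
      · simpa [hj] using hv j (mem_univ j)
    have h3 : (fun j => Function.update v i x j - v₀) = Function.update b i (x - v₀) := by
      ext1 j
      by_cases hj : j = i
      · subst hj; simp
      · simp [hj, hbv]
    have h4 : (fun j => v j - v₀) = b := by ext1 j; rw [hbv]
    simp only [hf] at h2 hpos
    rw [h3, h4, h1, abs_mul] at h2
    rw [h4] at hpos
    exact (mul_le_iff_le_one_right hpos).1 h2
  refine ⟨b.equivFun.toContinuousLinearEquiv, v₀ + ∑ i, (1 / (d + 1 : ℝ)) • b i, ?_, ?_⟩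
  · intro x hx i
    have h1 := hcoord x hx i
    have h2 : (b.equivFun (x - (v₀ + ∑ i, (1 / (d + 1 : ℝ)) • b i))) i =
        b.repr (x - v₀) i - 1 / (d + 1) := by
      rw [← sub_sub, map_sub, Pi.sub_apply, b.equivFun_apply]
      congr 1
      have := congrFun (b.equivFun.apply_symm_apply fun _ => (1 / (d + 1 : ℝ))) i
      rwa [b.equivFun_symm_apply] at this
    have h3 : |(1 / (d + 1) : ℝ)| ≤ 1 := by
      rw [abs_of_nonneg (by positivity), div_le_one (by positivity)]
      linarith [Nat.cast_nonneg (α := ℝ) d]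
    change |(b.equivFun (x - (v₀ + ∑ i, (1 / (d + 1 : ℝ)) • b i))) i| ≤ 2
    rw [h2]
    exact (abs_sub _ _).trans (by linarith)
  · intro y hy
    change v₀ + ∑ i, (1 / (d + 1 : ℝ)) • b i + b.equivFun.symm y ∈ G
    rw [b.equivFun_symm_apply]
    have hd : (0 : ℝ) < d + 1 := by positivity
    set w : Option (Fin d) → ℝ := fun o => o.elim (1 - ∑ i, (1 / (d + 1 : ℝ) + y i))
      fun i => 1 / (d + 1 : ℝ) + y i with hw
    have hyi : ∀ i, |y i| ≤ 1 / (d + 1) := fun i =>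
      (Finset.single_le_sum (f := fun j => |y j|) (fun j _ => abs_nonneg _)
        (Finset.mem_univ i)).trans hy
    have hsum : ∑ i, (1 / (d + 1 : ℝ) + y i) ≤ 1 := by
      rw [Finset.sum_add_distrib, Finset.sum_const, Finset.card_univ, Fintype.card_fin,
        nsmul_eq_mul]
      have h1 : ∑ i, y i ≤ 1 / (d + 1) := (Finset.sum_le_sum fun i _ => le_abs_self _).trans hy
      have h2 : (d : ℝ) * (1 / (d + 1)) + 1 / (d + 1) = 1 := by field_simp
      linarith
    have key := hconv.sum_mem (t := Finset.univ) (w := w)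
      (z := fun o => o.elim v₀ v) ?_ ?_ ?_
    · rw [Fintype.sum_option] at key
      convert key using 1
      simp only [hw, Option.elim, hbv, smul_sub, Finset.sum_sub_distrib, add_smul,
        Finset.sum_add_distrib, sub_smul, one_smul, ← Finset.sum_smul]
      abel
    · rintro (_ | i) _
      · simp only [hw, Option.elim]; linarith
      · simp only [hw, Option.elim]; linarith [(abs_le.1 (hyi i)).1]
    · rw [Fintype.sum_option]; simp [hw]
    · rintro (_ | i) _
      · exact hv₀G
      · exact hv i (mem_univ i)

end Position

section Main

theorem IsConvexGauge.gauge {E : Type*} [NormedAddCommGroup E] [NormedSpace ℝ E] {K : Set E}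
    (hK : IsCompact K) (hconv : Convex ℝ K) (h0 : K ∈ nhds 0) :
    IsConvexGauge (gauge K) ∧ {x | gauge K x ≤ 1} = K := by
  have hset : {x | _root_.gauge K x ≤ 1} = K := by
    ext x
    rw [mem_ofPred_eq, gauge_le_one_iff_mem_closure hconv h0, hK.isClosed.closure_eq]
  refine ⟨⟨gauge_add_le hconv (absorbent_nhds_zero h0), fun c hc x => ?_, gauge_nonneg,
    continuous_gauge hconv h0, ?_⟩, hset⟩
  swap
  · rw [hset]
    exact hK
  rw [gauge_smul_of_nonneg hc, smul_eq_mul]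

theorem unifMeasure_apply_of_subset {d : ℕ} {G S : Set (Euc d)} (hS : MeasurableSet S)
    (hSG : S ⊆ G) : unifMeasure G S = (volume G)⁻¹ * volume S := by
  rw [unifMeasure, Measure.smul_apply, Measure.restrict_apply hS, inter_eq_left.2 hSG, smul_eq_mul]

theorem IsConvexBody.volume_pos {d : ℕ} {G : Set (Euc d)} (hG : IsConvexBody G) :
    volume G ≠ 0 :=
  (Measure.measure_pos_of_nonempty_interior _ hG.2.2).ne'

theorem IsConvexBody.isProbabilityMeasure_unifMeasure {d : ℕ} {G : Set (Euc d)}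
    (hG : IsConvexBody G) : IsProbabilityMeasure (unifMeasure G) := by
  constructor
  rw [unifMeasure, Measure.smul_apply, Measure.restrict_apply_univ, smul_eq_mul]
  exact ENNReal.inv_mul_cancel hG.volume_pos hG.1.measure_lt_top.ne

theorem depth_le_box_volume {d : ℕ} (hd : 1 ≤ d) {N τ s c : ℝ} (hτ : 0 < τ)
    (hN : N * τ ^ (d + 1) = 1) (hc : c = (1 / (16 * d * (d + 1))) ^ d) (hs : 0 ≤ s) :
    c / τ ^ 2 * min s τ ≤ N * ((τ / (2 * (d + 1)) / (2 * d)) ^ (d - 1) *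
      min (s / (2 * (d + 1))) (τ / (2 * (d + 1)) / (2 * d)) / 4 ^ d) := by
  obtain ⟨k, rfl⟩ : ∃ k, d = k + 1 := ⟨d - 1, by omega⟩
  rw [Nat.add_sub_cancel]
  have hN' : N = 1 / τ ^ (k + 1 + 1) := by rw [eq_div_iff (by positivity), hN]
  have hN0 : 0 ≤ N := by rw [hN']; positivity
  set δ : ℝ := ((k + 1 : ℕ) : ℝ)
  have hδ : 1 ≤ δ := Nat.one_le_cast.2 hd
  set q : ℝ := 1 / (4 * δ * (δ + 1)) with hq
  have hq0 : 0 < q := by positivity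
  have e1 : τ / (2 * (δ + 1)) / (2 * δ) = q * τ := by rw [hq]; field_simp; norm_num
  have e2 : c = q ^ (k + 1) / 4 ^ (k + 1) := by
    rw [hc, ← div_pow, hq]
    congr 1
    field_simp
    norm_num
  have e3 : q * min s τ ≤ min (s / (2 * (δ + 1))) (q * τ) := by
    refine le_min ?_ (by gcongr; exact min_le_right _ _)
    calc q * min s τ ≤ q * s := by gcongr; exact min_le_left _ _
      _ ≤ 1 / (2 * (δ + 1)) * s := by
        rw [hq]
        gcongr
        linarith
      _ = _ := by ring
  rw [e1]
  calc c / τ ^ 2 * min s τ = N * ((q * τ) ^ k * (q * min s τ) / 4 ^ (k + 1)) := by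
        rw [e2, hN']
        field_simp
        ring
    _ ≤ _ := by gcongr

theorem IsConvexBody.lintegral_missing_volume_le {d : ℕ} (hd : 1 ≤ d) {G : Set (Euc d)}
    (hG : IsConvexBody G) {n : ℕ} {τ : ℝ} (hτ : 0 < τ) (hτ1 : τ ≤ 1)
    (hnτ : n * τ ^ (d + 1) = 1) {c : ℝ} (hc : c = (1 / (16 * d * (d + 1))) ^ d) :
    ∫⁻ ω, volume (G \ convexHull ℝ (range ω)) ∂(sampleMeasure G n) ≤
      ENNReal.ofReal ((2 ^ d * (2 / c * 2 ^ d + 2 / c ^ 2) + 4 * (d * 4 ^ d)) * τ ^ 2) *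
        volume G := by
  have hdpos : (0 : ℝ) < d := by exact_mod_cast hd
  have : Nonempty (Fin d) := ⟨⟨0, hd⟩⟩
  have := hG.isProbabilityMeasure_unifMeasure
  have hc0 : 0 < c := by rw [hc]; positivity
  obtain ⟨e, x₀, hbdd, hnear⟩ := hG.exists_position
  set T : Euc d → Fin d → ℝ := fun x => e (x - x₀) with hT
  have hTm : Measurable T := by fun_prop
  set K : Set (Fin d → ℝ) := {y | x₀ + e.symm y ∈ G} with hK
  have hTK : ∀ x, T x ∈ K ↔ x ∈ G := fun x => by simp [hT, hK]
  have hKG : T ⁻¹' K = G := by ext x; exact hTK x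
  have hKT : K = T '' G := by
    ext y
    constructor
    · intro hy
      exact ⟨_, hy, by simp [hT]⟩
    · rintro ⟨x, hx, rfl⟩
      exact (hTK x).2 hx
  have hKc : IsCompact K := hKT ▸ hG.1.image (by fun_prop)
  have hKconv : Convex ℝ K :=
    (hG.2.1.translate_preimage_right x₀).linear_preimage (e.symm : (Fin d → ℝ) →ₗ[ℝ] Euc d)
  have hK0 : K ∈ nhds 0 := by
    have : {y : Fin d → ℝ | ∑ i, |y i| < 1 / (d + 1)} ∈ nhds 0 := by
      refine (isOpen_lt (by fun_prop) continuous_const).mem_nhds ?_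
      simp only [mem_ofPred_eq, Pi.zero_apply, abs_zero, Finset.sum_const_zero]
      positivity
    exact Filter.mem_of_superset this fun y hy => hnear y (le_of_lt hy)
  obtain ⟨hp, hpK⟩ := IsConvexGauge.gauge hKc hKconv hK0
  set p := gauge K
  have hL0 : (0 : ℝ) < d + 1 := by positivity
  have hL : ∀ y : Fin d → ℝ, ∑ i, |y i| = 1 → p y ≤ d + 1 := by
    intro y hy
    have h1 : (1 / (d + 1 : ℝ)) • y ∈ K := by
      refine hnear _ ?_
      simp only [Pi.smul_apply, smul_eq_mul, abs_mul]
      rw [← Finset.mul_sum, hy, mul_one, abs_of_nonneg (by positivity)]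
    rw [← hpK, mem_ofPred_eq, hp.map_smul _ (by positivity)] at h1
    rw [one_div, inv_mul_le_iff₀ hL0] at h1
    linarith
  have hsingle : ∀ i : Fin d, ∑ j, |(Pi.single i 1 : Fin d → ℝ) j| = 1 := fun i => by
    simp [Pi.single_apply, apply_ite abs]
  have hL₁ : ∀ i : Fin d, p (Pi.single i 1) ≤ d + 1 := fun i => hL _ (hsingle i)
  have hL₂ : ∀ i : Fin d, p (-Pi.single i 1) ≤ d + 1 := fun i =>
    hL _ (by simpa only [Pi.neg_apply, abs_neg] using hsingle i)
  set μ : Measure (Fin d → ℝ) := volume.map e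
  have : μ.IsAddHaarMeasure := e.isAddHaarMeasure_map volume
  have hmapT : (volume : Measure (Euc d)).map T = μ := by
    have : T = e ∘ fun x => x - x₀ := rfl
    rw [this, ← Measure.map_map (by fun_prop) (by fun_prop),
      (measurePreserving_sub_right volume x₀).map_eq]
  have hvolT : ∀ S : Set (Fin d → ℝ), MeasurableSet S → volume (T ⁻¹' S) = μ S := fun S hS => by
    rw [← hmapT, Measure.map_apply hTm hS]
  have hGm : MeasurableSet G := hG.1.measurableSet
  have hvolG : volume G = μ K := by rw [← hvolT K hKc.measurableSet, hKG]
  set k := μ.addHaarScalarFactor volume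
  have hμk : μ = k • volume := Measure.isAddLeftInvariant_eq_smul μ volume
  have hvolK : volume K ≤ ENNReal.ofReal (4 ^ d) := by
    have hsub : K ⊆ Set.pi univ fun _ : Fin d => Icc (-2 : ℝ) 2 := by
      intro y hy i _
      have := hbdd _ hy i
      rw [add_sub_cancel_left, e.apply_symm_apply] at this
      exact abs_le.1 this
    refine (measure_mono hsub).trans_eq ?_
    rw [volume_pi_pi]
    simp only [Real.volume_Icc, Finset.prod_const, Finset.card_univ, Fintype.card_fin]
    rw [← ENNReal.ofReal_pow (by norm_num)]
    norm_num
  have hk0 : (k : ℝ≥0∞) ≠ 0 := by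
    intro h
    apply hG.volume_pos
    rw [hvolG, hμk]
    simp [ENNReal.coe_eq_zero.1 h]
  set η : ℝ := τ / (2 * (d + 1)) with hη
  set bad : Set (Fin d → ℝ) := {y | p y ≤ 1 ∧ (1 - p y) / 4 <
    ∑ i, (p (y + Pi.single i η) + p (y - Pi.single i η) - 2 * p y)}
  have hpc : Continuous p := hp.continuous
  have hpm : Measurable p := hpc.measurable
  have hbm : MeasurableSet bad := by
    have h1 : Measurable fun y => (1 - p y) / 4 := by fun_prop
    have h2 : Measurable fun y => ∑ i, (p (y + Pi.single i η) + p (y - Pi.single i η) - 2 * p y) :=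
      Continuous.measurable (by fun_prop)
    exact (measurableSet_le hpm measurable_const).inter (measurableSet_lt h1 h2)
  have hpoint : ∀ x ∈ G, sampleMeasure G n {ω | x ∉ convexHull ℝ (range ω)} ≤
      ENNReal.ofReal (2 ^ d * Real.exp (-(c / τ ^ 2 * min (1 - p (T x)) τ))) +
        bad.indicator 1 (T x) := by
    intro x hx
    have hpx : p (T x) ≤ 1 := by
      have : T x ∈ {y | p y ≤ 1} := hpK ▸ (hTK x).2 hx
      exact this
    by_cases hxb : T x ∈ bad
    · have : IsProbabilityMeasure (sampleMeasure G n) := by unfold sampleMeasure; infer_instance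
      simp only [indicator, hxb, if_true, Pi.one_apply]
      exact prob_le_one.trans le_add_self
    · have hD : ∑ i, (p (T x + Pi.single i η) + p (T x - Pi.single i η) - 2 * p (T x)) ≤
          (1 - p (T x)) / 4 := by
        by_contra h
        exact hxb ⟨hpx, not_le.1 h⟩
      obtain ⟨S, hSm, hSK, hSv, hSf⟩ := hp.exists_surrounding_boxes hL0 hL₁ hL₂
        (by positivity : 0 < η) (sub_nonneg.2 hpx) (by simp) hD
      rw [Fintype.card_fin] at hSv
      simp only [indicator, hxb, if_false, add_zero]
      set v := (η / (2 * d)) ^ (d - 1) * min ((1 - p (T x)) / (2 * (d + 1))) (η / (2 * d)) with hv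
      have hP : ∀ ε, ENNReal.ofReal (v / 4 ^ d) ≤ unifMeasure G (T ⁻¹' S ε) := by
        intro ε
        have hsub : T ⁻¹' S ε ⊆ G := by
          rw [← hKG, ← hpK]
          exact preimage_mono (hSK ε)
        rw [unifMeasure_apply_of_subset (hTm (hSm ε)) hsub, hvolT _ (hSm ε), hvolG, hμk,
          Measure.smul_apply, Measure.smul_apply, hSv ε, ENNReal.smul_def, ENNReal.smul_def,
          smul_eq_mul, smul_eq_mul, ENNReal.mul_inv (Or.inl hk0) (Or.inl ENNReal.coe_ne_top),
          mul_mul_mul_comm, ENNReal.inv_mul_cancel hk0 ENNReal.coe_ne_top, one_mul,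
          div_eq_inv_mul, ENNReal.ofReal_mul (by positivity),
          ENNReal.ofReal_inv_of_pos (by positivity)]
        gcongr
      have hmain := measure_notMem_convexHull_le (n := n) (unifMeasure G)
        (fun ε => hTm (hSm ε)) hP (x := x) (by
          intro f
          obtain ⟨ε, hε⟩ := hSf (f ∘ₗ (e.symm : (Fin d → ℝ) →ₗ[ℝ] Euc d))
          refine ⟨ε, fun z hz => ?_⟩
          have := hε _ hz
          simpa [hT] using this)
      refine hmain.trans ?_
      rw [ENNReal.ofReal_mul (by positivity)]
      refine mul_le_mul' ?_ (ENNReal.ofReal_le_ofReal (Real.exp_le_exp.2 (neg_le_neg ?_)))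
      · simp [ENNReal.ofReal_pow]
      · rw [hv, hη]
        exact depth_le_box_volume hd hτ hnτ hc (sub_nonneg.2 hpx)
  calc ∫⁻ ω, volume (G \ convexHull ℝ (range ω)) ∂(sampleMeasure G n)
      = ∫⁻ x in G, sampleMeasure G n {ω | x ∉ convexHull ℝ (range ω)} := by
        unfold sampleMeasure
        exact lintegral_measure_diff_convexHull _ _ _
    _ ≤ ∫⁻ x in G, (ENNReal.ofReal (2 ^ d * Real.exp (-(c / τ ^ 2 * min (1 - p (T x)) τ))) +
        bad.indicator 1 (T x)) := setLIntegral_mono' hGm hpoint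
    _ = ∫⁻ y in K, (ENNReal.ofReal (2 ^ d * Real.exp (-(c / τ ^ 2 * min (1 - p y) τ))) +
        bad.indicator 1 y) ∂μ := by
        have hΦ : Measurable fun y =>
            ENNReal.ofReal (2 ^ d * Real.exp (-(c / τ ^ 2 * min (1 - p y) τ))) +
              bad.indicator 1 y :=
          Measurable.add (Measurable.ennreal_ofReal (by fun_prop)) (measurable_one.indicator hbm)
        rw [← hmapT, setLIntegral_map hKc.measurableSet hΦ hTm, hKG]
    _ ≤ _ := by
        have := hp.lintegral_failure_le μ hL0 hL₁ hL₂ hτ hτ1 hc0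
          (A := 2 ^ d) (by positivity)
        rwa [hpK, Fintype.card_fin, ← hvolG] at this

end Main

/-- The convex hull of `n` i.i.d. uniform points in a convex body `G ⊆ ℝ^d` estimates `G`
in the Nikodym metric at the minimax rate `n^{-2/(d+1)}`, uniformly over all convex bodies. -/
theorem convex_hull_estimator_upper_bound (d : ℕ) (hd : 1 ≤ d) :
    ∃ C : ℝ, 0 < C ∧
      ∀ n : ℕ, 1 ≤ n →
        ∀ G : Set (Euc d), IsConvexBody G →
          (∫ ω, (volume (G \ convexHull ℝ (Set.range ω))).toReal / (volume G).toReal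
              ∂(sampleMeasure G n)) ≤ C * (n : ℝ) ^ (-(2 : ℝ) / ((d : ℝ) + 1)) := by
  have hdpos : (0 : ℝ) < d := by exact_mod_cast hd
  set c : ℝ := (1 / (16 * d * (d + 1))) ^ d with hc
  have hc0 : 0 < c := by positivity
  refine ⟨2 ^ d * (2 / c * 2 ^ d + 2 / c ^ 2) + 4 * (d * 4 ^ d), by positivity, ?_⟩
  intro n hn G hG
  set C : ℝ := 2 ^ d * (2 / c * 2 ^ d + 2 / c ^ 2) + 4 * (d * 4 ^ d)
  have hn0 : (0 : ℝ) < n := by exact_mod_cast hn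
  set τ : ℝ := (n : ℝ) ^ (-1 / ((d : ℝ) + 1)) with hτ
  have hτ0 : 0 < τ := by positivity
  have hτ1 : τ ≤ 1 := Real.rpow_le_one_of_one_le_of_nonpos (by exact_mod_cast hn)
    (div_nonpos_of_nonpos_of_nonneg (by norm_num) (by positivity))
  have hnτ : n * τ ^ (d + 1) = 1 := by
    rw [hτ, ← Real.rpow_natCast, ← Real.rpow_mul hn0.le]
    push_cast
    rw [div_mul_cancel₀ _ (by positivity), Real.rpow_neg_one]
    field_simp
  have hτ2 : τ ^ 2 = (n : ℝ) ^ (-(2 : ℝ) / ((d : ℝ) + 1)) := by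
    rw [hτ, ← Real.rpow_natCast, ← Real.rpow_mul hn0.le]
    congr 1
    push_cast
    ring
  have hfin : volume G ≠ ⊤ := hG.1.measure_lt_top.ne
  have hvpos : 0 < (volume G).toReal := ENNReal.toReal_pos hG.volume_pos hfin
  have hmain := hG.lintegral_missing_volume_le hd hτ0 hτ1 hnτ hc
  rw [integral_div, div_le_iff₀ hvpos, ← hτ2]
  refine (Real.le_norm_self _).trans ((norm_integral_le_lintegral_norm _).trans ?_)
  have h1 : ∀ ω : Fin n → Euc d, ENNReal.ofReal
      ‖(volume (G \ convexHull ℝ (Set.range ω))).toReal‖ =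
        volume (G \ convexHull ℝ (Set.range ω)) := fun ω => by
    rw [Real.norm_of_nonneg ENNReal.toReal_nonneg, ENNReal.ofReal_toReal
      (measure_ne_top_of_subset sdiff_subset hfin)]
  simp only [h1]
  refine (ENNReal.toReal_mono (ENNReal.mul_ne_top ENNReal.ofReal_ne_top hfin) hmain).trans_eq ?_
  rw [ENNReal.toReal_mul, ENNReal.toReal_ofReal (by positivity)]
end
end

section
/- Let d ≥ 1. There exists a constant c(d) > 0 such that for every integer n ≥ 1 and every estimator Ĝ_n — that is, every map assigning to each sample (x_1, …, x_n) ∈ (ℝ^d)^n a measurable subset Ĝ_n(x_1,…,x_n) ⊆ ℝ^d, such that the function ((x_1,…,x_n), y) ↦ 1{y ∈ Ĝ_n(x_1,…,x_n)} is jointly measurable — one has sup over convex bodies G ⊆ ℝ^d of E_G[|G △ Ĝ_n(X_1,…,X_n)| / |G|] ≥ c(d)·n^{-2/(d+1)}, where X_1, …, X_n are i.i.d. uniform in G. -/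
open MeasureTheory Metric Set
open scoped RealInnerProductSpace ENNReal symmDiff

noncomputable section

namespace MeasureTheory.Measure

theorem pi_mono_of_le {ι : Type*} [Fintype ι] {α : ι → Type*} [∀ i, MeasurableSpace (α i)]
    {μ ν : ∀ i, Measure (α i)} (h : ∀ i, ν i ≤ μ i) : Measure.pi ν ≤ Measure.pi μ := by
  have hle : OuterMeasure.pi (fun i => (ν i).toOuterMeasure) ≤
      OuterMeasure.pi (fun i => (μ i).toOuterMeasure) := by
    rw [OuterMeasure.le_pi]
    intro s _
    refine (OuterMeasure.pi_pi_le _ s).trans ?_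
    exact Finset.prod_le_prod' fun i _ => h i (s i)
  refine Measure.le_iff.2 fun s hs => ?_
  rw [Measure.pi_def, Measure.pi_def, toMeasure_apply _ _ hs, toMeasure_apply _ _ hs]
  exact hle s

end MeasureTheory.Measure

/-- Bernoulli's inequality for a ratio of extended nonnegative reals. -/
theorem ENNReal.half_le_div_pow {a b w : ℝ≥0∞} {n : ℕ} (ha : a ≠ ∞) (hb : b ≠ 0)
    (h : a = b + w) (hn : 2 * n * w ≤ a) : 2⁻¹ ≤ (a⁻¹ * b) ^ n := by
  have hbt : b ≠ ∞ := fun hh => ha (by simp [h, hh])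
  have hwt : w ≠ ∞ := fun hh => ha (by simp [h, hh])
  lift b to NNReal using hbt
  lift w to NNReal using hwt
  lift a to NNReal using ha
  have hb' : (b : ℝ) ≠ 0 := by exact_mod_cast hb
  have hbpos : (0 : ℝ) < b := lt_of_le_of_ne b.2 hb'.symm
  have hab : (a : ℝ) = b + w := by exact_mod_cast h
  have hapos : (0 : ℝ) < a := by have := w.2; simp only [NNReal.val_eq_coe] at this; linarith
  have hane : a ≠ 0 := by rintro rfl; simp at hapos
  have hn' : 2 * (n : ℝ) * w ≤ a := by exact_mod_cast hn
  have key : (2⁻¹ : ℝ) ≤ ((a : ℝ)⁻¹ * b) ^ n := by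
    have hx : (a : ℝ)⁻¹ * b = 1 + (-(w / a) : ℝ) := by
      rw [eq_sub_of_add_eq hab.symm]; field_simp; ring
    have hw1 : (w : ℝ) / a ≤ 1 := by rw [div_le_one hapos]; linarith
    have := one_add_mul_le_pow (a := (-(w / a) : ℝ)) (by linarith) n
    rw [hx]
    refine le_trans ?_ this
    have : (n : ℝ) * (w / a) ≤ 1 / 2 := by
      rw [← mul_div_assoc, div_le_iff₀ hapos]; linarith
    linarith
  rw [← ENNReal.coe_inv hane]
  have : (2⁻¹ : NNReal) ≤ (a⁻¹ * b) ^ n := by exact_mod_cast key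
  have h2 : ((2⁻¹ : NNReal) : ℝ≥0∞) = 2⁻¹ := by simp
  rw [← h2]
  exact_mod_cast this

section TwoPoint

variable {d n : ℕ} {A B C K : Set (Euc d)} {Ghat : (Fin n → Euc d) → Set (Euc d)}

theorem measurable_volume_inter_symmDiff (hC : MeasurableSet C) (hA : MeasurableSet A)
    (hG : MeasurableSet {p : (Fin n → Euc d) × Euc d | p.2 ∈ Ghat p.1}) :
    Measurable fun ω => volume (C ∩ (A ∆ Ghat ω)) := by
  have : MeasurableSet ((univ ×ˢ C) ∩
      ((univ ×ˢ A) ∆ {p : (Fin n → Euc d) × Euc d | p.2 ∈ Ghat p.1})) :=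
    (MeasurableSet.univ.prod hC).inter ((MeasurableSet.univ.prod hA).symmDiff hG)
  have h := measurable_measure_prodMk_left (ν := (volume : Measure (Euc d))) this
  convert h using 3 with ω
  ext y
  simp [Set.mem_symmDiff]

/-- Two supports differing by a set `C` of measure at most `1 / (2 n)` of the larger one cannot
be told apart from `n` observations. -/
theorem half_volume_le_two_point (hA : MeasurableSet A) (hB : MeasurableSet B) (hBA : B ⊆ A)
    (hAt : volume A ≠ ∞) (hB0 : volume B ≠ 0) (hC : C = A \ B)
    (hn : 2 * n * volume C ≤ volume A)
    (hG : MeasurableSet {p : (Fin n → Euc d) × Euc d | p.2 ∈ Ghat p.1}) :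
    volume C / 2 ≤ (∫⁻ ω, volume (C ∩ (A ∆ Ghat ω)) ∂(sampleMeasure A n)) +
      ∫⁻ ω, volume (C ∩ (B ∆ Ghat ω)) ∂(sampleMeasure B n) := by
  have hCm : MeasurableSet C := hC ▸ hA.diff hB
  set ν : Measure (Euc d) := (volume A)⁻¹ • volume.restrict B with hν
  have hνA : ν ≤ unifMeasure A := by
    rw [hν, unifMeasure]; gcongr
  have hνB : ν ≤ unifMeasure B := by
    rw [hν, unifMeasure]
    intro s
    simp only [Measure.smul_apply, smul_eq_mul]
    gcongr
  have : IsFiniteMeasure ν := isFiniteMeasure_of_le _ hνA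
  have hsum : ∀ ω, volume C ≤ volume (C ∩ (A ∆ Ghat ω)) + volume (C ∩ (B ∆ Ghat ω)) := by
    intro ω
    refine (measure_mono ?_).trans (measure_union_le _ _)
    rintro y hy
    have hy' := hy
    rw [hC] at hy'
    by_cases hyG : y ∈ Ghat ω
    · exact Or.inr ⟨hy, Or.inr ⟨hyG, hy'.2⟩⟩
    · exact Or.inl ⟨hy, Or.inl ⟨hy'.1, hyG⟩⟩
  have hmass : 2⁻¹ ≤ Measure.pi (fun _ : Fin n => ν) univ := by
    rw [Measure.pi_univ]
    simp only [hν, Measure.smul_apply, smul_eq_mul, Measure.restrict_apply_univ,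
      Finset.prod_const, Finset.card_univ, Fintype.card_fin]
    refine ENNReal.half_le_div_pow hAt hB0 ?_ hn
    rw [hC, measure_sdiff hBA hB.nullMeasurableSet (measure_ne_top_of_subset hBA hAt)]
    exact (add_tsub_cancel_of_le (measure_mono hBA)).symm
  calc volume C / 2 ≤ volume C * Measure.pi (fun _ : Fin n => ν) univ := by
        rw [div_eq_mul_inv]; gcongr
    _ = ∫⁻ _, volume C ∂(Measure.pi fun _ : Fin n => ν) := by rw [lintegral_const]
    _ ≤ ∫⁻ ω, (volume (C ∩ (A ∆ Ghat ω)) + volume (C ∩ (B ∆ Ghat ω)))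
          ∂(Measure.pi fun _ : Fin n => ν) := lintegral_mono hsum
    _ = (∫⁻ ω, volume (C ∩ (A ∆ Ghat ω)) ∂(Measure.pi fun _ : Fin n => ν)) +
          ∫⁻ ω, volume (C ∩ (B ∆ Ghat ω)) ∂(Measure.pi fun _ : Fin n => ν) :=
        lintegral_add_left (measurable_volume_inter_symmDiff hCm hA hG) _
    _ ≤ _ := add_le_add
        (lintegral_mono' (Measure.pi_mono_of_le fun _ => hνA) le_rfl)
        (lintegral_mono' (Measure.pi_mono_of_le fun _ => hνB) le_rfl)

end TwoPoint

/-- Assouad's lemma for the bodies `K \ ⋃ j ∈ S, C j` obtained from `K` by removing some of the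
disjoint pieces `C j`. -/
theorem assouad_removed_pieces {d n : ℕ} {ι : Type*} [Fintype ι] {K : Set (Euc d)}
    {C : ι → Set (Euc d)} {w : ℝ≥0∞} {Ghat : (Fin n → Euc d) → Set (Euc d)}
    (hK : MeasurableSet K) (hKt : volume K ≠ ∞) (hC : ∀ j, MeasurableSet (C j))
    (hCK : ∀ j, C j ⊆ K) (hdisj : Pairwise (Function.onFun Disjoint C))
    (hw : ∀ j, volume (C j) = w)
    (hconv : ∀ S : Finset ι, IsConvexBody (K \ ⋃ j ∈ S, C j))
    (hn : 2 * n * w ≤ volume (K \ ⋃ j, C j))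
    (hG : MeasurableSet {p : (Fin n → Euc d) × Euc d | p.2 ∈ Ghat p.1}) :
    Fintype.card ι * w / (4 * volume K) ≤
      ⨆ (G : Set (Euc d)) (_ : IsConvexBody G),
        ∫⁻ ω, volume (G ∆ Ghat ω) / volume G ∂(sampleMeasure G n) := by
  classical
  set sup := ⨆ (G : Set (Euc d)) (_ : IsConvexBody G),
        ∫⁻ ω, volume (G ∆ Ghat ω) / volume G ∂(sampleMeasure G n)
  set G : Finset ι → Set (Euc d) := fun S => K \ ⋃ j ∈ S, C j with hGdef
  have hGm : ∀ S, MeasurableSet (G S) := fun S =>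
    hK.diff (Finset.measurableSet_biUnion _ fun j _ => hC j)
  have hGK : ∀ S, G S ⊆ K := fun S => sdiff_subset
  have hG0 : ∀ S, volume (G S) ≠ 0 := fun S =>
    (Measure.measure_pos_of_nonempty_interior volume (hconv S).2.2).ne'
  set a : ι → Finset ι → ℝ≥0∞ := fun j S =>
    ∫⁻ ω, volume (C j ∩ (G S ∆ Ghat ω)) ∂(sampleMeasure (G S) n) with ha
  have hinsert : ∀ j S, j ∉ S → w / 2 ≤ a j S + a j (insert j S) := by
    intro j S hj
    rw [← hw j]
    have hGi : G (insert j S) = G S \ C j := by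
      simp only [hGdef, Finset.set_biUnion_insert]
      rw [union_comm, ← Set.sdiff_sdiff]
    have hCG : C j ⊆ G S := by
      intro y hy
      refine ⟨hCK j hy, ?_⟩
      simp only [mem_iUnion, not_exists]
      intro i hi hyi
      exact (hdisj (ne_of_mem_of_not_mem hi hj)).le_bot ⟨hyi, hy⟩
    refine half_volume_le_two_point (hGm S) (hGm _) (hGi ▸ sdiff_subset)
      (measure_ne_top_of_subset (hGK S) hKt) (hG0 _) ?_ ?_ hG
    · rw [hGi, sdiff_sdiff_cancel_left hCG]
    · rw [hw j]
      refine hn.trans (measure_mono ?_)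
      exact sdiff_subset_sdiff_right (iUnion₂_subset fun i _ => subset_iUnion C i)
  have hpair : ∀ j S, w / 2 ≤ a j S + a j (S ∆ {j}) := by
    intro j S
    by_cases hj : j ∈ S
    · have h1 : S ∆ {j} = S.erase j := by
        ext i; by_cases hi : i = j <;> simp [Finset.mem_symmDiff, hi, hj]
      have := hinsert j (S.erase j) (Finset.notMem_erase j S)
      rwa [Finset.insert_erase hj, add_comm, ← h1] at this
    · have h1 : S ∆ {j} = insert j S := by
        ext i; by_cases hi : i = j <;> simp [Finset.mem_symmDiff, hi, hj]
      rw [h1]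
      exact hinsert j S hj
  have hflip : ∀ j, ∑ S, a j (S ∆ {j}) = ∑ S, a j S := fun j =>
    Function.Bijective.sum_comp
      (Function.Involutive.bijective (f := fun S : Finset ι => S ∆ {j})
        fun S => symmDiff_symmDiff_cancel_right _ _) (a j)
  have hcol : ∀ j, Fintype.card (Finset ι) * (w / 2) ≤ 2 * ∑ S, a j S := by
    intro j
    calc (Fintype.card (Finset ι) : ℝ≥0∞) * (w / 2) = ∑ _S : Finset ι, w / 2 := by
          simp [Finset.sum_const]
      _ ≤ ∑ S, (a j S + a j (S ∆ {j})) := Finset.sum_le_sum fun S _ => hpair j S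
      _ = 2 * ∑ S, a j S := by rw [Finset.sum_add_distrib, hflip, two_mul]
  have hrow : ∀ S, ∑ j, a j S ≤ volume K * sup := by
    intro S
    have hle : ∫⁻ ω, volume (G S ∆ Ghat ω) / volume (G S) ∂(sampleMeasure (G S) n) ≤ sup :=
      le_iSup₂_of_le (G S) (hconv S) le_rfl
    calc ∑ j, a j S
        = ∫⁻ ω, ∑ j, volume (C j ∩ (G S ∆ Ghat ω)) ∂(sampleMeasure (G S) n) :=
          (lintegral_finsetSum _ fun j _ =>
            measurable_volume_inter_symmDiff (hC j) (hGm S) hG).symm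
      _ ≤ ∫⁻ ω, volume K * (volume (G S ∆ Ghat ω) / volume (G S))
            ∂(sampleMeasure (G S) n) := by
          refine lintegral_mono fun ω => ?_
          have hmeas : MeasurableSet (G S ∆ Ghat ω) :=
            (hGm S).symmDiff (measurable_prodMk_left hG)
          calc ∑ j, volume (C j ∩ (G S ∆ Ghat ω))
              = volume (⋃ j, C j ∩ (G S ∆ Ghat ω)) := by
                rw [measure_iUnion _ fun j => (hC j).inter hmeas, tsum_fintype]
                exact fun i j hij => (hdisj hij).mono inter_subset_left inter_subset_left
            _ ≤ volume (G S ∆ Ghat ω) :=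
                measure_mono (iUnion_subset fun j => inter_subset_right)
            _ = volume (G S) * (volume (G S ∆ Ghat ω) / volume (G S)) :=
                (ENNReal.mul_div_cancel (hG0 S)
                  (measure_ne_top_of_subset (hGK S) hKt)).symm
            _ ≤ _ := by gcongr; exact hGK S
      _ = volume K * ∫⁻ ω, volume (G S ∆ Ghat ω) / volume (G S)
            ∂(sampleMeasure (G S) n) := lintegral_const_mul' _ _ hKt
      _ ≤ _ := by gcongr
  have htot : (Fintype.card (Finset ι) : ℝ≥0∞) * (Fintype.card ι * w) ≤
      Fintype.card (Finset ι) * (4 * volume K * sup) := by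
    calc (Fintype.card (Finset ι) : ℝ≥0∞) * (Fintype.card ι * w)
        = 2 * ∑ _j : ι, Fintype.card (Finset ι) * (w / 2) := by
          rw [Finset.sum_const, nsmul_eq_mul, Finset.card_univ]
          have : w = 2 * (w / 2) := (ENNReal.mul_div_cancel two_ne_zero ENNReal.ofNat_ne_top).symm
          conv_lhs => rw [this]
          ring
      _ ≤ 2 * ∑ j, 2 * ∑ S, a j S :=
          mul_le_mul_right (Finset.sum_le_sum fun j _ => hcol j) 2
      _ = 4 * ∑ S, ∑ j, a j S := by
          rw [← Finset.mul_sum, Finset.sum_comm]; ring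
      _ ≤ 4 * ∑ _S : Finset ι, volume K * sup := by gcongr with S; exact hrow S
      _ = _ := by
          rw [Finset.sum_const, nsmul_eq_mul, Finset.card_univ]; ring
  have hcard : (Fintype.card (Finset ι) : ℝ≥0∞) ≠ 0 := by
    exact_mod_cast Fintype.card_ne_zero
  rw [ENNReal.mul_le_mul_iff_right hcard (ENNReal.natCast_ne_top _)] at htot
  exact ENNReal.div_le_of_le_mul' htot

/-- The sum of squares of all coordinates but the first. -/
def tailSq {m : ℕ} (p : Euc (m + 1)) : ℝ := ∑ i : Fin m, (p i.succ) ^ 2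

/-- The part of the paraboloid `tailSq p ≤ p 0` below height `R`. -/
def truncParaboloid (m : ℕ) (R : ℝ) : Set (Euc (m + 1)) := {p | tailSq p ≤ p 0 ∧ p 0 ≤ R}

/-- The cap of the paraboloid lying below its tangent hyperplane over `z`, raised by `s ^ 2`. -/
def paraboloidCap {m : ℕ} (z : Fin m → ℝ) (s : ℝ) : Set (Euc (m + 1)) :=
  {p | tailSq p ≤ p 0 ∧ p 0 < ∑ i, (2 * z i * p i.succ - z i ^ 2) + s ^ 2}

/-- The matrix of the linear map carrying the cap `0 ≤ tailSq p ≤ p 0 < 1` to `paraboloidCap z s`,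
up to translation. -/
def capMatrix {m : ℕ} (z : Fin m → ℝ) (s : ℝ) : Matrix (Fin (m + 1)) (Fin (m + 1)) ℝ :=
  Matrix.of (Fin.cons (Fin.cons (s ^ 2) fun i => 2 * z i * s)
    fun i => Fin.cons 0 fun j => if i = j then s else 0)

section Paraboloid

variable {m : ℕ}

theorem continuous_tailSq : Continuous (tailSq : Euc (m + 1) → ℝ) := by
  unfold tailSq; fun_prop

theorem continuous_coord (i : Fin (m + 1)) : Continuous fun p : Euc (m + 1) => p i := by
  fun_prop

theorem continuous_tangent (z : Fin m → ℝ) (s : ℝ) :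
    Continuous fun p : Euc (m + 1) => ∑ i, (2 * z i * p i.succ - z i ^ 2) + s ^ 2 := by
  fun_prop

theorem convexOn_tailSq : ConvexOn ℝ univ (tailSq : Euc (m + 1) → ℝ) := by
  refine ⟨convex_univ, fun x _ y _ a b ha hb hab => ?_⟩
  simp only [tailSq, smul_eq_mul, Finset.mul_sum, ← Finset.sum_add_distrib, PiLp.add_apply,
    PiLp.smul_apply]
  refine Finset.sum_le_sum fun i _ => ?_
  obtain rfl : b = 1 - a := by linarith
  nlinarith [mul_nonneg (mul_nonneg ha hb) (sq_nonneg (x i.succ - y i.succ))]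

theorem isCompact_truncParaboloid (R : ℝ) : IsCompact (truncParaboloid m R) := by
  refine Metric.isCompact_of_isClosed_isBounded ?_ ?_
  · exact (isClosed_le continuous_tailSq (continuous_coord 0)).inter
      (isClosed_le (continuous_coord 0) continuous_const)
  · refine (Metric.isBounded_closedBall (x := (0 : Euc (m + 1))) (r := R + 1)).subset ?_
    rintro p ⟨h1, h2⟩
    have h0 : 0 ≤ tailSq p := Finset.sum_nonneg fun i _ => sq_nonneg _
    rw [mem_closedBall_zero_iff]
    refine abs_le_of_sq_le_sq' (b := R + 1) ?_ (by linarith) |>.2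
    rw [EuclideanSpace.norm_sq_eq, Fin.sum_univ_succ]
    simp only [Real.norm_eq_abs, sq_abs]
    change p 0 ^ 2 + tailSq p ≤ _
    nlinarith

theorem convex_truncParaboloid (R : ℝ) : Convex ℝ (truncParaboloid m R) := by
  intro x hx y hy a b ha hb hab
  have h := convexOn_tailSq.2 (mem_univ x) (mem_univ y) ha hb hab
  simp only [smul_eq_mul] at h
  have h1 := mul_le_mul_of_nonneg_left hx.1 ha
  have h2 := mul_le_mul_of_nonneg_left hy.1 hb
  have h3 := mul_le_mul_of_nonneg_left hx.2 ha
  have h4 := mul_le_mul_of_nonneg_left hy.2 hb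
  refine ⟨?_, ?_⟩
  · simp only [PiLp.add_apply, PiLp.smul_apply, smul_eq_mul]
    linarith
  · simp only [PiLp.add_apply, PiLp.smul_apply, smul_eq_mul]
    have : a * R + b * R = R := by rw [← add_mul, hab, one_mul]
    linarith

theorem sum_sub_sq_eq_tailSq_sub (z : Fin m → ℝ) (p : Euc (m + 1)) :
    ∑ i, (p i.succ - z i) ^ 2 = tailSq p - ∑ i, (2 * z i * p i.succ - z i ^ 2) := by
  rw [tailSq, ← Finset.sum_sub_distrib]
  exact Finset.sum_congr rfl fun i _ => by ring

theorem sum_sub_sq_lt_of_mem_paraboloidCap {z : Fin m → ℝ} {s : ℝ} {p : Euc (m + 1)}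
    (hp : p ∈ paraboloidCap z s) : ∑ i, (p i.succ - z i) ^ 2 < s ^ 2 := by
  rw [sum_sub_sq_eq_tailSq_sub]
  linarith [hp.1, hp.2]

theorem abs_sub_lt_of_mem_paraboloidCap {z : Fin m → ℝ} {s : ℝ} (hs : 0 ≤ s) {p : Euc (m + 1)}
    (hp : p ∈ paraboloidCap z s) (i : Fin m) : |p i.succ - z i| < s :=
  abs_lt_of_sq_lt_sq ((Finset.single_le_sum (f := fun i => (p i.succ - z i) ^ 2)
    (fun _ _ => sq_nonneg _) (Finset.mem_univ i)).trans_lt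
      (sum_sub_sq_lt_of_mem_paraboloidCap hp)) hs

theorem lt_tailSq_add_of_mem_paraboloidCap {z : Fin m → ℝ} {s : ℝ} {p : Euc (m + 1)}
    (hp : p ∈ paraboloidCap z s) : p 0 < tailSq p + s ^ 2 := by
  have h := sum_sub_sq_eq_tailSq_sub z p
  have h1 : 0 ≤ ∑ i, (p i.succ - z i) ^ 2 := Finset.sum_nonneg fun i _ => sq_nonneg _
  have h2 := hp.2
  linarith

theorem measurableSet_paraboloidCap (z : Fin m → ℝ) (s : ℝ) :
    MeasurableSet (paraboloidCap z s) :=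
  (isClosed_le continuous_tailSq (continuous_coord 0)).measurableSet.inter
    (isOpen_lt (continuous_coord 0) (continuous_tangent z s)).measurableSet

theorem convex_le_tangent (z : Fin m → ℝ) (s : ℝ) :
    Convex ℝ {p : Euc (m + 1) | ∑ i, (2 * z i * p i.succ - z i ^ 2) + s ^ 2 ≤ p 0} := by
  have hlin : IsLinearMap ℝ fun p : Euc (m + 1) => p 0 - ∑ i, 2 * z i * p i.succ := by
    constructor
    · intro x y
      simp only [PiLp.add_apply, mul_add, Finset.sum_add_distrib]
      ring
    · intro c x
      simp only [PiLp.smul_apply, smul_eq_mul, mul_sub, Finset.mul_sum]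
      congr 1
      exact Finset.sum_congr rfl fun i _ => by ring
  have h : {p : Euc (m + 1) | ∑ i, (2 * z i * p i.succ - z i ^ 2) + s ^ 2 ≤ p 0} =
      {p | s ^ 2 - ∑ i, z i ^ 2 ≤ p 0 - ∑ i, 2 * z i * p i.succ} := by
    ext p
    simp only [mem_ofPred_eq, Finset.sum_sub_distrib]
    constructor <;> intro h <;> linarith
  rw [h]
  exact convex_halfSpace_ge hlin _

theorem isOpen_paraboloid_above (R : ℝ) :
    IsOpen {p : Euc (m + 1) | tailSq p + 1 < p 0 ∧ p 0 < R} :=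
  (isOpen_lt (continuous_tailSq.add continuous_const) (continuous_coord 0)).inter
    (isOpen_lt (continuous_coord 0) continuous_const)

theorem paraboloid_above_nonempty {R : ℝ} (hR : 2 < R) :
    {p : Euc (m + 1) | tailSq p + 1 < p 0 ∧ p 0 < R}.Nonempty := by
  refine ⟨EuclideanSpace.single 0 2, ?_⟩
  simp [tailSq, hR]

theorem paraboloid_above_subset {ι : Type*} {R s : ℝ} {z : ι → Fin m → ℝ} (hs : s ^ 2 ≤ 1)
    (S : Set ι) :
    {p : Euc (m + 1) | tailSq p + 1 < p 0 ∧ p 0 < R} ⊆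
      truncParaboloid m R \ ⋃ j ∈ S, paraboloidCap (z j) s := by
  rintro p ⟨h1, h2⟩
  refine ⟨⟨by linarith, h2.le⟩, ?_⟩
  simp only [mem_iUnion, not_exists]
  intro j _ hp
  have := lt_tailSq_add_of_mem_paraboloidCap hp
  linarith

theorem isConvexBody_truncParaboloid_diff {ι : Type*} {R s : ℝ} (hR : 2 < R) {z : ι → Fin m → ℝ}
    (hs : s ^ 2 ≤ 1) (S : Set ι) :
    IsConvexBody (truncParaboloid m R \ ⋃ j ∈ S, paraboloidCap (z j) s) := by
  have h : truncParaboloid m R \ ⋃ j ∈ S, paraboloidCap (z j) s = truncParaboloid m R ∩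
      ⋂ j ∈ S, {p | ∑ i, (2 * z j i * p i.succ - z j i ^ 2) + s ^ 2 ≤ p 0} := by
    ext p
    simp only [mem_sdiff, mem_inter_iff, mem_iUnion, mem_iInter, not_exists, mem_ofPred_eq]
    refine and_congr_right fun hp => forall₂_congr fun j _ => ?_
    rw [paraboloidCap, mem_ofPred_eq, not_and, not_lt]
    exact ⟨fun H => H hp.1, fun H _ => H⟩
  refine ⟨?_, ?_, ?_⟩
  · rw [h]
    exact (isCompact_truncParaboloid R).inter_right
      (isClosed_biInter fun j _ => isClosed_le (continuous_tangent _ _) (continuous_coord 0))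
  · rw [h]
    exact (convex_truncParaboloid R).inter (convex_iInter₂ fun j _ => convex_le_tangent _ _)
  · exact (paraboloid_above_nonempty hR).mono
      ((isOpen_paraboloid_above R).subset_interior_iff.2 (paraboloid_above_subset hs S))

theorem det_capMatrix (z : Fin m → ℝ) (s : ℝ) : (capMatrix z s).det = s ^ (m + 2) := by
  rw [Matrix.det_of_isUpperTriangular]
  · rw [Fin.prod_univ_succ]
    simp [capMatrix]
    ring
  · intro i j hij
    induction i using Fin.cases with
    | zero => simp at hij
    | succ i =>
      induction j using Fin.cases with
      | zero => simp [capMatrix]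
      | succ j =>
        have : i ≠ j := by rintro rfl; simp at hij
        simp [capMatrix, this]

theorem volume_paraboloidCap (z : Fin m → ℝ) {s : ℝ} (hs : 0 < s) :
    volume (paraboloidCap z s) =
      ENNReal.ofReal (s ^ (m + 2)) * volume (paraboloidCap (0 : Fin m → ℝ) 1) := by
  set L : Euc (m + 1) →ₗ[ℝ] Euc (m + 1) := Matrix.toLpLin 2 2 (capMatrix z s) with hL
  have hdet : LinearMap.det L = s ^ (m + 2) := by
    rw [hL, Matrix.toLpLin_eq_toLin, LinearMap.det_toLin, det_capMatrix]
  have hpos : 0 < s ^ (m + 2) := by positivity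
  have hL0 : ∀ p, L p 0 = s ^ 2 * p 0 + ∑ i, 2 * z i * s * p i.succ := by
    intro p
    simp [hL, Matrix.toLpLin_apply, Matrix.mulVec, dotProduct, capMatrix, Fin.sum_univ_succ]
  have hLs : ∀ p (i : Fin m), L p i.succ = s * p i.succ := by
    intro p i
    simp [hL, Matrix.toLpLin_apply, Matrix.mulVec, dotProduct, capMatrix, Fin.sum_univ_succ]
  set a : Euc (m + 1) := WithLp.toLp 2 (Fin.cons (∑ i, z i ^ 2) z) with ha
  have hpre : L ⁻¹' ((fun p => p + a) ⁻¹' paraboloidCap z s) =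
      paraboloidCap (0 : Fin m → ℝ) 1 := by
    ext p
    have h1 : tailSq (L p + a) = s ^ 2 * tailSq p + ∑ i, 2 * z i * s * p i.succ
        + ∑ i, z i ^ 2 := by
      simp only [tailSq, PiLp.add_apply, hLs, ha, Fin.cons_succ, Finset.mul_sum,
        ← Finset.sum_add_distrib]
      exact Finset.sum_congr rfl fun i _ => by ring
    have h2 : (L p + a) 0 = s ^ 2 * p 0 + ∑ i, 2 * z i * s * p i.succ + ∑ i, z i ^ 2 := by
      simp [hL0, ha]
    have h3 : ∑ i, (2 * z i * (L p + a) i.succ - z i ^ 2) =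
        ∑ i, 2 * z i * s * p i.succ + ∑ i, z i ^ 2 := by
      simp only [PiLp.add_apply, hLs, ha, Fin.cons_succ, ← Finset.sum_add_distrib]
      exact Finset.sum_congr rfl fun i _ => by ring
    have hs2 : 0 < s ^ 2 := by positivity
    simp only [paraboloidCap, mem_preimage, mem_ofPred_eq, h1, h2, h3]
    refine and_congr ?_ ?_
    · rw [add_le_add_iff_right, add_le_add_iff_right, mul_le_mul_iff_right₀ hs2]
    · simp only [Pi.zero_apply, mul_zero, zero_mul, ne_eq, OfNat.ofNat_ne_zero, not_false_eq_true,
        zero_pow, sub_zero, Finset.sum_const_zero, one_pow, zero_add]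
      constructor <;> intro h <;> nlinarith
  have h := Measure.addHaar_preimage_linearMap (volume : Measure (Euc (m + 1)))
    (f := L) (by rw [hdet]; exact hpos.ne') ((fun p => p + a) ⁻¹' paraboloidCap z s)
  rw [hpre, hdet, measure_preimage_add_right, abs_of_pos (inv_pos.2 hpos)] at h
  rw [h, ← mul_assoc, ← ENNReal.ofReal_mul hpos.le, mul_inv_cancel₀ hpos.ne', ENNReal.ofReal_one,
    one_mul]

theorem paraboloidCap_subset_truncParaboloid {z : Fin m → ℝ} {s : ℝ} (hs : 0 ≤ s) (hs1 : s ≤ 1)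
    (hz : ∀ i, |z i| ≤ 2) : paraboloidCap z s ⊆ truncParaboloid m (9 * m + 3) := by
  intro p hp
  refine ⟨hp.1, ?_⟩
  have hle : tailSq p ≤ ∑ _i : Fin m, (9 : ℝ) := by
    refine Finset.sum_le_sum fun i _ => ?_
    have h1 := (abs_sub_lt_of_mem_paraboloidCap hs hp i).le
    have h2 : |p i.succ| ≤ 3 := by
      calc |p i.succ| = |(p i.succ - z i) + z i| := by ring_nf
        _ ≤ _ := abs_add_le _ _
        _ ≤ 3 := by linarith [hz i]
    have := abs_le.1 h2
    nlinarith
  have := lt_tailSq_add_of_mem_paraboloidCap hp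
  simp only [Finset.sum_const, Finset.card_univ, Fintype.card_fin, nsmul_eq_mul] at hle
  nlinarith

theorem volume_unit_paraboloidCap_ne_top : volume (paraboloidCap (0 : Fin m → ℝ) 1) ≠ ∞ :=
  measure_ne_top_of_subset
    (paraboloidCap_subset_truncParaboloid zero_le_one le_rfl (by simp))
    (isCompact_truncParaboloid _).measure_lt_top.ne

theorem volume_unit_paraboloidCap_pos : 0 < volume (paraboloidCap (0 : Fin m → ℝ) 1) := by
  have ho : IsOpen {p : Euc (m + 1) | tailSq p < p 0 ∧ p 0 < 1} :=
    (isOpen_lt continuous_tailSq (continuous_coord 0)).inter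
      (isOpen_lt (continuous_coord 0) continuous_const)
  have hne : {p : Euc (m + 1) | tailSq p < p 0 ∧ p 0 < 1}.Nonempty := by
    refine ⟨EuclideanSpace.single 0 2⁻¹, ?_⟩
    simp [tailSq]
    norm_num
  refine (ho.measure_pos volume hne).trans_le (measure_mono ?_)
  rintro p ⟨h1, h2⟩
  exact ⟨h1.le, by simpa using h2⟩

/-- Caps centred at distinct points of the grid of mesh `2 s` are disjoint. -/
theorem disjoint_paraboloidCap_grid {N : ℕ} {s : ℝ} (hs : 0 ≤ s) :
    Pairwise (Function.onFun Disjoint fun k : Fin m → Fin N =>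
      paraboloidCap (fun i => 2 * s * (k i : ℕ)) s) := by
  intro k l hkl
  obtain ⟨i, hi⟩ := Function.ne_iff.1 hkl
  refine Set.disjoint_left.2 fun p hk hl => ?_
  have h1 := abs_lt.1 (abs_sub_lt_of_mem_paraboloidCap hs hk i)
  have h2 := abs_lt.1 (abs_sub_lt_of_mem_paraboloidCap hs hl i)
  rcases lt_or_gt_of_ne (fun h => hi (Fin.ext h) : (k i : ℕ) ≠ l i) with h | h
  · have : ((k i : ℕ) : ℝ) + 1 ≤ (l i : ℕ) := by exact_mod_cast h
    nlinarith
  · have : ((l i : ℕ) : ℝ) + 1 ≤ (k i : ℕ) := by exact_mod_cast h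
    nlinarith

end Paraboloid

/-- Minimax lower bound: no estimator of a convex body from `n` i.i.d. uniform observations
can beat the rate `n^{-2/(d+1)}` in the Nikodym metric, uniformly over all convex bodies. -/
theorem minimax_lower_bound_convex_support (d : ℕ) (hd : 1 ≤ d) :
    ∃ c : ℝ, 0 < c ∧
      ∀ n : ℕ, 1 ≤ n →
        ∀ Ghat : (Fin n → Euc d) → Set (Euc d),
          MeasurableSet {p : (Fin n → Euc d) × Euc d | p.2 ∈ Ghat p.1} →
          ENNReal.ofReal (c * (n : ℝ) ^ (-(2 : ℝ) / ((d : ℝ) + 1))) ≤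
            ⨆ (G : Set (Euc d)) (_ : IsConvexBody G),
              ∫⁻ ω, volume (G ∆ Ghat ω) / volume G ∂(sampleMeasure G n) := by
  obtain ⟨m, rfl⟩ : ∃ m, d = m + 1 := ⟨d - 1, by omega⟩
  set R : ℝ := 9 * m + 3
  have hR2 : 2 < R := by have : (0 : ℝ) ≤ m := m.cast_nonneg; linarith
  set K := truncParaboloid m R
  set U : Set (Euc (m + 1)) := {p | tailSq p + 1 < p 0 ∧ p 0 < R}
  have hKt : volume K ≠ ∞ := (isCompact_truncParaboloid R).measure_lt_top.ne
  have hUpos : 0 < volume U :=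
    (isOpen_paraboloid_above R).measure_pos volume (paraboloid_above_nonempty hR2)
  have hUK : U ⊆ K := fun p hp => ⟨by linarith [hp.1], hp.2.le⟩
  have hUt : volume U ≠ ∞ := measure_ne_top_of_subset hUK hKt
  have hKpos : 0 < volume K := hUpos.trans_le (measure_mono hUK)
  set v : ℝ := (volume (paraboloidCap (0 : Fin m → ℝ) 1)).toReal
  set b : ℝ := (volume U).toReal
  set κK : ℝ := (volume K).toReal
  have hv : 0 < v :=
    ENNReal.toReal_pos volume_unit_paraboloidCap_pos.ne' volume_unit_paraboloidCap_ne_top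
  have hb : 0 < b := ENNReal.toReal_pos hUpos.ne' hUt
  have hκK : 0 < κK := ENNReal.toReal_pos hKpos.ne' hKt
  set κ : ℝ := min 1 (b / (2 * v))
  have hκ : 0 < κ := by positivity
  refine ⟨2⁻¹ ^ m * v * κ ^ 2 / (4 * κK), by positivity, fun n hn Ghat hG => ?_⟩
  have hn1 : (1 : ℝ) ≤ n := by exact_mod_cast hn
  have hn0 : (0 : ℝ) < n := by linarith
  set ρ : ℝ := (n : ℝ) ^ (-(1 : ℝ) / ((m : ℝ) + 2)) with hρ
  have hρ0 : 0 < ρ := Real.rpow_pos_of_pos hn0 _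
  have hρ1 : ρ ≤ 1 := Real.rpow_le_one_of_one_le_of_nonpos hn1
    (div_nonpos_of_nonpos_of_nonneg (by norm_num) (by positivity))
  have hρ2 : (n : ℝ) ^ (-(2 : ℝ) / (((m + 1 : ℕ) : ℝ) + 1)) = ρ ^ 2 := by
    rw [hρ, ← Real.rpow_natCast, ← Real.rpow_mul hn0.le]
    congr 1
    push_cast
    field_simp
    ring
  have hρn : n * ρ ^ (m + 2) = 1 := by
    rw [hρ, ← Real.rpow_natCast, ← Real.rpow_mul hn0.le]
    have : -(1 : ℝ) / ((m : ℝ) + 2) * ((m + 2 : ℕ) : ℝ) = -1 := by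
      push_cast
      field_simp
    rw [this, Real.rpow_neg_one, mul_inv_cancel₀ hn0.ne']
  set s : ℝ := κ * ρ with hsdef
  have hs : 0 < s := by positivity
  have hs1 : s ≤ 1 := mul_le_one₀ (min_le_left _ _) hρ0.le hρ1
  have hs2 : s ^ 2 ≤ 1 := pow_le_one₀ hs.le hs1
  set N : ℕ := ⌊1 / s⌋₊
  have hNs : N * s ≤ 1 := by
    have := Nat.floor_le (one_div_nonneg.2 hs.le)
    rwa [le_div_iff₀ hs] at this
  have hNs' : 2⁻¹ ≤ N * s := by
    have h1 : 1 ≤ N := Nat.le_floor (by rw [Nat.cast_one, le_div_iff₀ hs]; linarith)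
    have h2 := Nat.lt_floor_add_one (1 / s)
    rw [div_lt_iff₀ hs] at h2
    have h3 : (1 : ℝ) ≤ N := by exact_mod_cast h1
    nlinarith
  set z : (Fin m → Fin N) → Fin m → ℝ := fun k i => 2 * s * (k i : ℕ)
  have hz : ∀ k i, |z k i| ≤ 2 := by
    intro k i
    have h1 : ((k i : ℕ) : ℝ) ≤ N := by exact_mod_cast (k i).2.le
    rw [abs_of_nonneg (by positivity)]
    nlinarith
  have hvol : ∀ k, volume (paraboloidCap (z k) s) = ENNReal.ofReal (s ^ (m + 2) * v) := by
    intro k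
    rw [volume_paraboloidCap _ hs, ENNReal.ofReal_mul (by positivity),
      ENNReal.ofReal_toReal volume_unit_paraboloidCap_ne_top]
  have hsn : 2 * n * (s ^ (m + 2) * v) ≤ b := by
    have h1 : κ ^ (m + 2) ≤ κ := pow_le_of_le_one hκ.le (min_le_left _ _) (by omega)
    have h2 : κ * (2 * v) ≤ b := by
      rw [← le_div_iff₀ (by positivity)]; exact min_le_right _ _
    calc 2 * n * (s ^ (m + 2) * v) = (n * ρ ^ (m + 2)) * (κ ^ (m + 2) * (2 * v)) := by
          rw [hsdef, mul_pow]; ring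
      _ ≤ κ * (2 * v) := by rw [hρn, one_mul]; gcongr
      _ ≤ b := h2
  have hmin : 2 * n * ENNReal.ofReal (s ^ (m + 2) * v) ≤
      volume (K \ ⋃ k, paraboloidCap (z k) s) := by
    have hU := paraboloid_above_subset (R := R) (z := z) hs2 univ
    simp only [mem_univ, iUnion_true] at hU
    refine le_trans ?_ (measure_mono hU)
    change _ ≤ volume U
    calc 2 * n * ENNReal.ofReal (s ^ (m + 2) * v)
        = ENNReal.ofReal (2 * n * (s ^ (m + 2) * v)) := by
          rw [ENNReal.ofReal_mul (p := 2 * (n : ℝ)) (by positivity), ENNReal.ofReal_mul zero_le_two,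
            ENNReal.ofReal_natCast, ENNReal.ofReal_ofNat]
      _ ≤ ENNReal.ofReal b := ENNReal.ofReal_le_ofReal hsn
      _ = volume U := ENNReal.ofReal_toReal hUt
  have hbody : ∀ S : Finset (Fin m → Fin N),
      IsConvexBody (K \ ⋃ k ∈ S, paraboloidCap (z k) s) := fun S =>
    isConvexBody_truncParaboloid_diff hR2 hs2 (S : Set (Fin m → Fin N))
  have hsub : ∀ k, paraboloidCap (z k) s ⊆ K := fun k =>
    paraboloidCap_subset_truncParaboloid hs.le hs1 (hz k)
  have hdisj : Pairwise (Function.onFun Disjoint fun k => paraboloidCap (z k) s) :=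
    disjoint_paraboloidCap_grid hs.le
  have key := assouad_removed_pieces (isCompact_truncParaboloid R).measurableSet hKt
    (fun k => measurableSet_paraboloidCap (z k) s) hsub hdisj hvol hbody hmin hG
  refine le_trans ?_ key
  rw [hρ2, ← ENNReal.ofReal_toReal hKt, ← ENNReal.ofReal_natCast, ← ENNReal.ofReal_ofNat 4,
    ← ENNReal.ofReal_mul (by positivity), ← ENNReal.ofReal_mul (by positivity),
    ← ENNReal.ofReal_div_of_pos (by positivity)]
  refine ENNReal.ofReal_le_ofReal ?_
  rw [div_mul_eq_mul_div]
  refine div_le_div_of_nonneg_right ?_ (by positivity)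
  simp only [Fintype.card_pi, Fintype.card_fin, Finset.prod_const, Finset.card_univ]
  calc 2⁻¹ ^ m * v * κ ^ 2 * ρ ^ 2 = 2⁻¹ ^ m * (v * s ^ 2) := by rw [hsdef]; ring
    _ ≤ (N * s) ^ m * (v * s ^ 2) := by gcongr
    _ = _ := by push_cast; ring
end
end
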